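/- Convergence to the limiting elliptic operator (Proposition 3.3): let α > 0, β < min{α, 2−α}, γ := (α−β)/(1−β), κ > 0, R ≥ 1, 0 < ν₁ ≤ ν₂. Let ν₀ : ℝ^d → [ν₁,ν₂] be C¹ with bounded derivative, let ν : ℝ^d×ℝ^d → (0,∞) satisfy ν₁⟨v⟩^β ≤ ν(x,v) ≤ ν₂⟨v⟩^β, x ↦ ν(x,v) C¹ with sup_{x,v}⟨v⟩^{−β}|∇_x ν(x,v)| < ∞, and ν(x,v) = ν₀(x)|v|^β for |v| ≥ R; let F : ℝ^d → (0,∞) satisfy ∫ F dv = 1 and F(v) = κ|v|^{−α−d} for |v| ≥ R. Define the drift j^ε := 0 if α < 1, j^ε := ∫_{|v| ≤ ε^{−1/(1−β)}} v F(v) dv if α = 1, and j^ε := ∫_{ℝ^d} v F(v) dv if α > 1. Then for every φ ∈ C_c^∞([0,∞)×ℝ^d), as ε → 0, ε^{−γ} ∫_{ℝ^d} ν(x,v) F(v) [ χ^ε(t,x,v) − φ(t,x) − (ε/ν(x,v)) j^ε·∇_x φ(t,x) ] dv converges, uniformly in (t,x), to (κ/(1−β)) lim_{δ→0⁺} ∫_{|y−x|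 ≥ δ} η(x,y) ( φ(t,y) − φ(t,x) ) / |x−y|^{d+γ} dy, where η(x,y) := ν₀(x) ν₀(y) ∫₀^∞ z^γ exp( −z ∫₀¹ ν₀(sx+(1−s)y) ds ) dz; i.e. the limit is −κ 𝓛*(φ)(t,x) for the elliptic operator 𝓛 of order γ defined by the principal value 𝓛(ρ)(x) := (1/(1−β)) PV ∫ η(x,y)(ρ(x)−ρ(y))/|x−y|^{d+γ} dy. -/

import Mathlib

open MeasureTheory Set

noncomputable section

abbrev Euc (d : ℕ) := EuclideanSpace ℝ (Fin d)

/-- `⌈v⌉^b`: equal to `1` for `|v| ≤ 1` and to `|v|^b` for `|v| ≥ 1`. -/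
noncomputable def jfloor {d : ℕ} (b : ℝ) (v : Euc d) : ℝ :=
  if ‖v‖ ≤ 1 then 1 else ‖v‖ ^ b

/-- The explicit solution `χ^ε` of the auxiliary transport problem. -/
noncomputable def chiAux {d : ℕ} (ν : Euc d → Euc d → ℝ) (β : ℝ)
    (φ : ℝ → Euc d → ℝ) (ε t : ℝ) (x v : Euc d) : ℝ :=
  ∫ z in Set.Ioi (0 : ℝ),
    jfloor (-β) v * ν (x + (ε * jfloor (-β) v * z) • v) v *
      Real.exp (-(∫ s in (0 : ℝ)..z, jfloor (-β) v * ν (x + (ε * jfloor (-β) v * s) • v) v)) *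
      φ t (x + (ε * jfloor (-β) v * z) • v)

/-- The kernel of the limiting elliptic operator. -/
noncomputable def etaKer {d : ℕ} (ν₀ : Euc d → ℝ) (γ : ℝ) (x y : Euc d) : ℝ :=
  ν₀ x * ν₀ y * ∫ z in Set.Ioi (0 : ℝ),
    z ^ γ * Real.exp (-(z * ∫ s in (0 : ℝ)..1, ν₀ (s • x + (1 - s) • y)))

/-- The drift term `j^ε_F`. -/
noncomputable def jdrift {d : ℕ} (F : Euc d → ℝ) (α β ε : ℝ) : Euc d :=
  if α < 1 then 0
  else if α = 1 then ∫ v in Metric.closedBall (0 : Euc d) (ε ^ (-(1 / (1 - β)))), F v • v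
  else ∫ v, F v • v

structure NuOK {d : ℕ} (f : Euc d → ℝ) (m1 m2 l : ℝ) : Prop where
  pos : 0 < m1
  cont : Continuous f
  lo : ∀ y, m1 ≤ f y
  hi : ∀ y, f y ≤ m2
  lnn : 0 ≤ l
  lip : ∀ x y, |f y - f x| ≤ l * ‖y - x‖

structure PsiOK {d : ℕ} (ψ : Euc d → ℝ) (D : Euc d → Euc d →L[ℝ] ℝ) (M C1 C2 : ℝ) : Prop where
  cont : Continuous ψ
  bd : ∀ y, |ψ y| ≤ M
  c1nn : 0 ≤ C1
  c2nn : 0 ≤ C2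
  first : ∀ x h, |ψ (x + h) - ψ x| ≤ C1 * ‖h‖
  second : ∀ x h, |ψ (x + h) - ψ x - D x h| ≤ C2 * ‖h‖ ^ 2

def pk {d : ℕ} (f : Euc d → ℝ) (x : Euc d) (z : ℝ) (h : Euc d) : ℝ :=
  f (x + h) * Real.exp (-(z * ∫ s in (0 : ℝ)..1, f (x + s • h)))

def kk {d : ℕ} (f ψ : Euc d → ℝ) (x : Euc d) (z : ℝ) (h : Euc d) : ℝ :=
  pk f x z h * (ψ (x + h) - ψ x)

def Kc (m2 l M C1 C2 : ℝ) : ℝ := m2 * (2 * M) + m2 * C1 + (l * (1 + m2) * C1 + m2 * C2)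

section part1
variable {d : ℕ} {f ψ : Euc d → ℝ} {m1 m2 l M C1 C2 : ℝ} {D : Euc d → Euc d →L[ℝ] ℝ}

theorem NuOK.m2pos (hf : NuOK f m1 m2 l) : 0 < m2 :=
  hf.pos.trans_le ((hf.lo 0).trans (hf.hi 0))

theorem PsiOK.Mnn (hψ : PsiOK ψ D M C1 C2) : 0 ≤ M := (abs_nonneg _).trans (hψ.bd 0)

theorem Kc_nonneg (hf : NuOK f m1 m2 l) (hψ : PsiOK ψ D M C1 C2) : 0 ≤ Kc m2 l M C1 C2 := by
  have h1 := hf.m2pos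
  have h2 := hψ.Mnn
  have h3 := hψ.c1nn
  have h4 := hψ.c2nn
  have h5 := hf.lnn
  unfold Kc; positivity

theorem NuOK.ii (hf : NuOK f m1 m2 l) (x h : Euc d) (a b : ℝ) :
    IntervalIntegrable (fun s : ℝ => f (x + s • h)) volume a b := by
  have := hf.cont
  exact Continuous.intervalIntegrable (by fun_prop) _ _

theorem avg_lo (hf : NuOK f m1 m2 l) (x h : Euc d) : m1 ≤ ∫ s in (0 : ℝ)..1, f (x + s • h) := by
  have := intervalIntegral.integral_mono_on (μ := volume) (f := fun _ => m1) (zero_le_one' ℝ)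
    (by simp) (hf.ii x h 0 1) (fun s _ => hf.lo _)
  simpa using this

theorem avg_diff (hf : NuOK f m1 m2 l) (x h : Euc d) :
    |(∫ s in (0 : ℝ)..1, f (x + s • h)) - f x| ≤ l * ‖h‖ := by
  have e : (∫ s in (0 : ℝ)..1, f (x + s • h)) - f x = ∫ s in (0 : ℝ)..1, (f (x + s • h) - f x) := by
    rw [intervalIntegral.integral_sub (hf.ii x h 0 1) (by simp)]; simp
  rw [e]
  have := intervalIntegral.norm_integral_le_of_norm_le_const (a := 0) (b := 1) (C := l * ‖h‖)
    (f := fun s : ℝ => f (x + s • h) - f x) (by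
      intro s hs
      rw [uIoc_of_le zero_le_one] at hs
      have := hf.lip x (x + s • h)
      rw [Real.norm_eq_abs]
      refine this.trans ?_
      rw [add_sub_cancel_left, norm_smul, Real.norm_eq_abs, abs_of_pos hs.1]
      have := hf.lnn
      have h2 : s * ‖h‖ ≤ ‖h‖ := by nlinarith [norm_nonneg h, hs.2]
      gcongr)
  simpa using this

theorem pk_nonneg (hf : NuOK f m1 m2 l) (x h : Euc d) (z : ℝ) : 0 ≤ pk f x z h :=
  mul_nonneg (hf.pos.le.trans (hf.lo _)) (Real.exp_pos _).le

theorem exp_le_aux {a b z : ℝ} (hz : 0 ≤ z) (h : a ≤ b) :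
    Real.exp (-(z * b)) ≤ Real.exp (-(z * a)) := by
  apply Real.exp_le_exp.2
  nlinarith

theorem pk_le (hf : NuOK f m1 m2 l) (x h : Euc d) {z : ℝ} (hz : 0 ≤ z) :
    pk f x z h ≤ m2 * Real.exp (-(z * m1)) := by
  unfold pk
  have := hf.m2pos
  exact mul_le_mul (hf.hi _) (exp_le_aux hz (avg_lo hf x h)) (Real.exp_pos _).le this.le

theorem exp_diff {a b c : ℝ} (ha : c ≤ a) (hb : c ≤ b) :
    |Real.exp (-a) - Real.exp (-b)| ≤ Real.exp (-c) * |a - b| := by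
  wlog hab : a ≤ b generalizing a b
  · rw [abs_sub_comm, abs_sub_comm a b]
    exact this hb ha (le_of_not_ge hab)
  have h1 : Real.exp (-b) ≤ Real.exp (-a) := Real.exp_le_exp.2 (by linarith)
  rw [abs_of_nonneg (by linarith), abs_of_nonpos (by linarith)]
  have h2 : Real.exp (-b) = Real.exp (-a) * Real.exp (a - b) := by
    rw [← Real.exp_add]; ring_nf
  have h3 := Real.add_one_le_exp (a - b)
  have h4 : Real.exp (-a) ≤ Real.exp (-c) := Real.exp_le_exp.2 (by linarith)
  have h5 := Real.exp_pos (-a)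
  rw [h2]
  have : Real.exp (-a) - Real.exp (-a) * Real.exp (a - b) ≤ Real.exp (-a) * (b - a) := by nlinarith
  refine this.trans ?_
  rw [neg_sub]
  exact mul_le_mul_of_nonneg_right h4 (by linarith)

theorem pk_diff (hf : NuOK f m1 m2 l) (x h : Euc d) {z : ℝ} (hz : 0 ≤ z) :
    |pk f x z h - f x * Real.exp (-(z * f x))| ≤
      l * ‖h‖ * (1 + z * m2) * Real.exp (-(z * m1)) := by
  unfold pk
  set A := ∫ s in (0 : ℝ)..1, f (x + s • h) with hA
  have e : f (x + h) * Real.exp (-(z * A)) - f x * Real.exp (-(z * f x)) =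
      (f (x + h) - f x) * Real.exp (-(z * A)) + f x * (Real.exp (-(z * A)) - Real.exp (-(z * f x))) := by
    ring
  rw [e]
  have h1 : |f (x + h) - f x| ≤ l * ‖h‖ := by simpa using hf.lip x (x + h)
  have h2 : Real.exp (-(z * A)) ≤ Real.exp (-(z * m1)) := exp_le_aux hz (avg_lo hf x h)
  have h3 := exp_diff (a := z * A) (b := z * f x) (c := z * m1)
    (mul_le_mul_of_nonneg_left (avg_lo hf x h) hz) (mul_le_mul_of_nonneg_left (hf.lo x) hz)
  have h4 : |z * A - z * f x| ≤ z * (l * ‖h‖) := by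
    rw [← mul_sub, abs_mul, abs_of_nonneg hz]
    exact mul_le_mul_of_nonneg_left (avg_diff hf x h) hz
  have hE := Real.exp_pos (-(z * m1))
  have hl : 0 ≤ l * ‖h‖ := mul_nonneg hf.lnn (norm_nonneg _)
  refine (abs_add_le _ _).trans ?_
  rw [abs_mul, abs_mul, abs_of_pos (Real.exp_pos _), abs_of_pos (hf.pos.trans_le (hf.lo x))]
  have h5 : |f (x + h) - f x| * Real.exp (-(z * A)) ≤ l * ‖h‖ * Real.exp (-(z * m1)) :=
    mul_le_mul h1 h2 (Real.exp_pos _).le hl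
  have h6 : f x * |Real.exp (-(z * A)) - Real.exp (-(z * f x))| ≤
      m2 * (Real.exp (-(z * m1)) * (z * (l * ‖h‖))) :=
    mul_le_mul (hf.hi x) (h3.trans (mul_le_mul_of_nonneg_left h4 hE.le)) (abs_nonneg _) hf.m2pos.le
  linarith

theorem kk_bd (hf : NuOK f m1 m2 l) (hψ : PsiOK ψ D M C1 C2) (x h : Euc d) {z : ℝ} (hz : 0 ≤ z) :
    |kk f ψ x z h| ≤ Kc m2 l M C1 C2 * Real.exp (-(z * m1)) := by
  unfold kk
  have h1 := hf.m2pos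
  have h2 := hψ.Mnn
  have h3 := hψ.c1nn
  have h4 := hψ.c2nn
  have h5 := hf.lnn
  rw [abs_mul, abs_of_nonneg (pk_nonneg hf x h z)]
  have h6 : |ψ (x + h) - ψ x| ≤ 2 * M := by
    have := hψ.bd (x + h); have := hψ.bd x
    rw [abs_le] at *; constructor <;> linarith
  have h7 := mul_le_mul (pk_le hf x h hz) h6 (abs_nonneg _) (by positivity)
  refine h7.trans ?_
  have : m2 * (2 * M) ≤ Kc m2 l M C1 C2 := by
    unfold Kc
    have : 0 ≤ m2 * C1 + (l * (1 + m2) * C1 + m2 * C2) := by positivity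
    linarith
  calc _ = (m2 * (2 * M)) * Real.exp (-(z * m1)) := by ring
    _ ≤ _ := by gcongr

theorem kk_lin (hf : NuOK f m1 m2 l) (hψ : PsiOK ψ D M C1 C2) (x h : Euc d) {z : ℝ} (hz : 0 ≤ z) :
    |kk f ψ x z h| ≤ Kc m2 l M C1 C2 * ‖h‖ * Real.exp (-(z * m1)) := by
  unfold kk
  have h1 := hf.m2pos
  have h2 := hψ.Mnn
  have h3 := hψ.c1nn
  have h4 := hψ.c2nn
  have h5 := hf.lnn
  rw [abs_mul, abs_of_nonneg (pk_nonneg hf x h z)]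
  have h7 := mul_le_mul (pk_le hf x h hz) (hψ.first x h) (abs_nonneg _) (by positivity)
  refine h7.trans ?_
  have : m2 * C1 ≤ Kc m2 l M C1 C2 := by
    unfold Kc
    have : 0 ≤ m2 * (2 * M) + (l * (1 + m2) * C1 + m2 * C2) := by positivity
    linarith
  calc _ = (m2 * C1) * ‖h‖ * Real.exp (-(z * m1)) := by ring
    _ ≤ _ := by gcongr

theorem kk_quad (hf : NuOK f m1 m2 l) (hψ : PsiOK ψ D M C1 C2) (x h : Euc d) {z : ℝ} (hz : 0 ≤ z) :
    |kk f ψ x z h - f x * Real.exp (-(z * f x)) * D x h| ≤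
      Kc m2 l M C1 C2 * ‖h‖ ^ 2 * ((1 + z) * Real.exp (-(z * m1))) := by
  unfold kk
  have h1 := hf.m2pos
  have h2 := hψ.Mnn
  have h3 := hψ.c1nn
  have h4 := hψ.c2nn
  have h5 := hf.lnn
  have e : pk f x z h * (ψ (x + h) - ψ x) - f x * Real.exp (-(z * f x)) * D x h =
      (pk f x z h - f x * Real.exp (-(z * f x))) * (ψ (x + h) - ψ x) +
      f x * Real.exp (-(z * f x)) * (ψ (x + h) - ψ x - D x h) := by ring
  rw [e]
  refine (abs_add_le _ _).trans ?_
  rw [abs_mul, abs_mul, abs_mul, abs_of_pos (Real.exp_pos _),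
    abs_of_pos (hf.pos.trans_le (hf.lo x))]
  have hE := Real.exp_pos (-(z * m1))
  have a1 := mul_le_mul (pk_diff hf x h hz) (hψ.first x h) (abs_nonneg _) (by positivity)
  have a2 := mul_le_mul (mul_le_mul (hf.hi x) (exp_le_aux hz (hf.lo x)) (Real.exp_pos _).le h1.le)
    (hψ.second x h) (abs_nonneg _) (by positivity)
  refine (add_le_add a1 a2).trans ?_
  have : 0 ≤ (m2 * (2 * M) + m2 * C1) * (1 + z) := by positivity
  have b1 : l * (1 + z * m2) * C1 + m2 * C2 ≤ Kc m2 l M C1 C2 * (1 + z) := by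
    have : 0 ≤ (m2 * (2 * M) + m2 * C1) * (1 + z) + l * C1 * (m2 + z) + m2 * C2 * z := by positivity
    unfold Kc; linarith
  calc _ = (l * (1 + z * m2) * C1 + m2 * C2) * (‖h‖ ^ 2 * Real.exp (-(z * m1))) := by ring
    _ ≤ Kc m2 l M C1 C2 * (1 + z) * (‖h‖ ^ 2 * Real.exp (-(z * m1))) := by gcongr
    _ = _ := by ring

def ss {d : ℕ} (f ψ : Euc d → ℝ) (x : Euc d) (z : ℝ) (h : Euc d) : ℝ :=
  kk f ψ x z h + kk f ψ x z (-h)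

theorem ss_bd (hf : NuOK f m1 m2 l) (hψ : PsiOK ψ D M C1 C2) (x h : Euc d) {z : ℝ} (hz : 0 ≤ z) :
    |ss f ψ x z h| ≤
      (2 * Kc m2 l M C1 C2) * ((1 + z) * Real.exp (-(z * m1))) * min 1 (‖h‖ ^ 2) := by
  unfold ss
  have hK := Kc_nonneg hf hψ
  have hE := Real.exp_pos (-(z * m1))
  rcases min_choice 1 (‖h‖ ^ 2) with hm | hm <;> rw [hm]
  · have a1 := kk_bd hf hψ x h hz
    have a2 := kk_bd hf hψ x (-h) hz
    refine (abs_add_le _ _).trans ((add_le_add a1 a2).trans ?_)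
    have : 0 ≤ Kc m2 l M C1 C2 * z * Real.exp (-(z * m1)) := by positivity
    linarith
  · have a1 := kk_quad hf hψ x h hz
    have a2 := kk_quad hf hψ x (-h) hz
    have e : kk f ψ x z h + kk f ψ x z (-h) =
      (kk f ψ x z h - f x * Real.exp (-(z * f x)) * D x h) +
      (kk f ψ x z (-h) - f x * Real.exp (-(z * f x)) * D x (-h)) := by
      rw [map_neg]; ring
    rw [e]
    rw [norm_neg] at a2
    refine (abs_add_le _ _).trans ((add_le_add a1 a2).trans (le_of_eq ?_))
    ring

end part1
def Qf {d : ℕ} (f ψ : Euc d → ℝ) (x u : Euc d) : ℝ :=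
  ∫ z in Set.Ioi (0 : ℝ), f (x + z • u) * Real.exp (-(∫ s in (0 : ℝ)..z, f (x + s • u))) *
    ψ (x + z • u)

section part2
variable {d : ℕ} {f ψ : Euc d → ℝ} {m1 m2 l M C1 C2 : ℝ} {D : Euc d → Euc d →L[ℝ] ℝ}

theorem expint {a m : ℝ} (ha : -1 < a) (hm : 0 < m) :
    IntegrableOn (fun z : ℝ => z ^ a * Real.exp (-(z * m))) (Ioi 0) := by
  have := integrableOn_rpow_mul_exp_neg_mul_rpow ha one_pos hm
  refine this.congr_fun (fun z _ => ?_) measurableSet_Ioi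
  simp only [Real.rpow_one]
  ring_nf

theorem expint_nat (n : ℕ) {m : ℝ} (hm : 0 < m) :
    IntegrableOn (fun z : ℝ => z ^ n * Real.exp (-(z * m))) (Ioi 0) := by
  have := expint (a := n) (by have : (0 : ℝ) ≤ n := n.cast_nonneg; linarith) hm
  simpa using this

theorem pk_cont (hf : NuOK f m1 m2 l) (x : Euc d) :
    Continuous (fun q : ℝ × Euc d => pk f x q.1 q.2) := by
  have hc := hf.cont
  have : Continuous (fun h : Euc d => ∫ s in (0 : ℝ)..1, f (x + s • h)) := by
    apply intervalIntegral.continuous_parametric_intervalIntegral_of_continuous'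
    simp only [Function.uncurry_def]
    fun_prop
  unfold pk
  fun_prop

theorem kk_cont (hf : NuOK f m1 m2 l) (hψ : Continuous ψ) (x : Euc d) :
    Continuous (fun q : ℝ × Euc d => kk f ψ x q.1 q.2) := by
  have := pk_cont hf x
  unfold kk
  fun_prop

theorem ss_cont (hf : NuOK f m1 m2 l) (hψ : Continuous ψ) (x : Euc d) :
    Continuous (fun q : ℝ × Euc d => ss f ψ x q.1 q.2) := by
  have h1 := kk_cont hf hψ x
  have h2 := h1.comp (g := fun q : ℝ × Euc d => kk f ψ x q.1 q.2)
    (f := fun q : ℝ × Euc d => (q.1, -q.2)) (by fun_prop)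
  exact h1.add h2

theorem avg_scale (f : Euc d → ℝ) (x u : Euc d) (z : ℝ) :
    ∫ s in (0 : ℝ)..z, f (x + s • u) = z * ∫ s in (0 : ℝ)..1, f (x + s • (z • u)) := by
  have := intervalIntegral.mul_integral_comp_mul_right (a := 0) (b := 1)
    (f := fun s => f (x + s • u)) z
  simp only [zero_mul, one_mul] at this
  rw [← this]
  simp only [smul_smul]

theorem pk_eq (f : Euc d → ℝ) (x u : Euc d) (z : ℝ) :
    pk f x z (z • u) = f (x + z • u) * Real.exp (-(∫ s in (0 : ℝ)..z, f (x + s • u))) := by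
  rw [avg_scale]; rfl

theorem pk_int (hf : NuOK f m1 m2 l) (x u : Euc d) :
    IntegrableOn (fun z : ℝ => pk f x z (z • u)) (Ioi 0) := by
  refine Integrable.mono' ((expint_nat 0 hf.pos).const_mul m2) ?_ ?_
  · apply Continuous.aestronglyMeasurable
    exact (pk_cont hf x).comp (g := fun q : ℝ × Euc d => pk f x q.1 q.2)
      (f := fun z : ℝ => (z, z • u)) (by fun_prop)
  · refine (ae_restrict_iff' measurableSet_Ioi).2 (Filter.Eventually.of_forall fun z hz => ?_)
    rw [Real.norm_eq_abs, abs_of_nonneg (pk_nonneg hf _ _ _)]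
    simpa using pk_le hf x (z • u) (le_of_lt hz)

theorem pk_mass (hf : NuOK f m1 m2 l) (x u : Euc d) :
    ∫ z in Ioi (0 : ℝ), pk f x z (z • u) = 1 := by
  have hc : Continuous (fun s : ℝ => f (x + s • u)) := by
    have := hf.cont; fun_prop
  have h := integral_Ioi_of_hasDerivAt_of_tendsto' (a := 0) (m := (0 : ℝ))
    (f := fun z : ℝ => -Real.exp (-(∫ s in (0 : ℝ)..z, f (x + s • u))))
    (f' := fun z : ℝ => pk f x z (z • u)) ?_ (pk_int hf x u) ?_
  · simpa using h
  · intro z _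
    rw [pk_eq]
    have h1 : HasDerivAt (fun z : ℝ => ∫ s in (0 : ℝ)..z, f (x + s • u)) (f (x + z • u)) z :=
      intervalIntegral.integral_hasDerivAt_right (hc.intervalIntegrable _ _)
        hc.stronglyMeasurable.stronglyMeasurableAtFilter hc.continuousAt
    have h2 : HasDerivAt (fun z : ℝ => -Real.exp (-(∫ s in (0 : ℝ)..z, f (x + s • u))))
      (-(Real.exp (-(∫ s in (0 : ℝ)..z, f (x + s • u))) * -f (x + z • u))) z := (h1.neg.exp).neg
    refine h2.congr_deriv ?_
    rw [mul_neg, neg_neg, mul_comm]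
  · suffices hs : Filter.Tendsto (fun z : ℝ => Real.exp (-(∫ s in (0 : ℝ)..z, f (x + s • u))))
        Filter.atTop (nhds 0) by
      have := hs.neg
      rwa [neg_zero] at this
    apply squeeze_zero' (g := fun z : ℝ => Real.exp (-(z * m1)))
    · exact Filter.Eventually.of_forall fun z => (Real.exp_pos _).le
    · filter_upwards [Filter.eventually_ge_atTop 0] with z hz
      rw [avg_scale]
      exact exp_le_aux hz (avg_lo hf x _)
    · apply Real.tendsto_exp_neg_atTop_nhds_zero.comp
      exact Filter.tendsto_id.atTop_mul_const hf.pos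

theorem kk_int (hf : NuOK f m1 m2 l) (hψ : PsiOK ψ D M C1 C2) (x u : Euc d) :
    IntegrableOn (fun z : ℝ => kk f ψ x z (z • u)) (Ioi 0) := by
  refine Integrable.mono' ((expint_nat 0 hf.pos).const_mul (Kc m2 l M C1 C2)) ?_ ?_
  · apply Continuous.aestronglyMeasurable
    exact (kk_cont hf hψ.cont x).comp (g := fun q : ℝ × Euc d => kk f ψ x q.1 q.2)
      (f := fun z : ℝ => (z, z • u)) (by fun_prop)
  · refine (ae_restrict_iff' measurableSet_Ioi).2 (Filter.Eventually.of_forall fun z hz => ?_)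
    simpa using kk_bd hf hψ x (z • u) (le_of_lt hz)

theorem Qf_eq (hf : NuOK f m1 m2 l) (hψ : PsiOK ψ D M C1 C2) (x u : Euc d) :
    Qf f ψ x u - ψ x = ∫ z in Ioi (0 : ℝ), kk f ψ x z (z • u) := by
  have h1 : Qf f ψ x u = ∫ z in Ioi (0 : ℝ), (kk f ψ x z (z • u) + pk f x z (z • u) * ψ x) := by
    unfold Qf
    congr 1
    ext z
    rw [← pk_eq]
    unfold kk
    ring
  rw [h1, integral_add (kk_int hf hψ x u) ((pk_int hf x u).mul_const _), integral_mul_const,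
    pk_mass hf]
  ring

theorem Qf_bd (hf : NuOK f m1 m2 l) (hψ : PsiOK ψ D M C1 C2) (x u : Euc d) :
    |Qf f ψ x u - ψ x| ≤ Kc m2 l M C1 C2 * ∫ z in Ioi (0 : ℝ), Real.exp (-(z * m1)) := by
  rw [Qf_eq hf hψ, ← integral_const_mul]
  rw [← Real.norm_eq_abs]
  refine norm_integral_le_of_norm_le ?_ ?_
  · simpa using (expint_nat 0 hf.pos).const_mul (Kc m2 l M C1 C2)
  · refine (ae_restrict_iff' measurableSet_Ioi).2 (Filter.Eventually.of_forall fun z hz => ?_)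
    simpa using kk_bd hf hψ x (z • u) (le_of_lt hz)

theorem Qf_lin (hf : NuOK f m1 m2 l) (hψ : PsiOK ψ D M C1 C2) (x u : Euc d) :
    |Qf f ψ x u - ψ x| ≤ Kc m2 l M C1 C2 * ‖u‖ * ∫ z in Ioi (0 : ℝ), z * Real.exp (-(z * m1)) := by
  rw [Qf_eq hf hψ, ← integral_const_mul]
  rw [← Real.norm_eq_abs]
  refine norm_integral_le_of_norm_le ?_ ?_
  · simpa using (expint_nat 1 hf.pos).const_mul (Kc m2 l M C1 C2 * ‖u‖)
  · refine (ae_restrict_iff' measurableSet_Ioi).2 (Filter.Eventually.of_forall fun z hz => ?_)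
    refine (kk_lin hf hψ x (z • u) (le_of_lt hz)).trans (le_of_eq ?_)
    rw [norm_smul, Real.norm_eq_abs, abs_of_pos hz]
    ring

theorem quadint {m : ℝ} (hm : 0 < m) :
    IntegrableOn (fun z : ℝ => z ^ 2 * ((1 + z) * Real.exp (-(z * m)))) (Ioi 0) := by
  refine ((expint_nat 2 hm).add (expint_nat 3 hm)).congr_fun (fun z _ => ?_) measurableSet_Ioi
  simp only [Pi.add_apply]
  ring

theorem Qf_quad (hf : NuOK f m1 m2 l) (hψ : PsiOK ψ D M C1 C2) (x u : Euc d) :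
    |Qf f ψ x u - ψ x - D x u / f x| ≤ Kc m2 l M C1 C2 * ‖u‖ ^ 2 *
      ∫ z in Ioi (0 : ℝ), z ^ 2 * ((1 + z) * Real.exp (-(z * m1))) := by
  have hfx : 0 < f x := hf.pos.trans_le (hf.lo x)
  have e1 : D x u / f x = ∫ z in Ioi (0 : ℝ), f x * Real.exp (-(z * f x)) * D x (z • u) := by
    have := Real.integral_rpow_mul_exp_neg_mul_Ioi (a := 2) two_pos hfx
    have h2 : ∫ z in Ioi (0 : ℝ), f x * Real.exp (-(z * f x)) * D x (z • u) =
        ∫ z in Ioi (0 : ℝ), (f x * D x u) * (z ^ ((2 : ℝ) - 1) * Real.exp (-(f x * z))) := by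
      congr 1
      ext z
      rw [map_smul, smul_eq_mul, mul_comm z (f x)]
      norm_num
      ring
    rw [h2, integral_const_mul, this, Real.Gamma_two]
    norm_num
    field_simp
  rw [Qf_eq hf hψ, e1, ← integral_sub (kk_int hf hψ x u), ← integral_const_mul]
  · rw [← Real.norm_eq_abs]
    refine norm_integral_le_of_norm_le ((quadint hf.pos).const_mul _) ?_
    refine (ae_restrict_iff' measurableSet_Ioi).2 (Filter.Eventually.of_forall fun z hz => ?_)
    refine (kk_quad hf hψ x (z • u) (le_of_lt hz)).trans (le_of_eq ?_)
    rw [norm_smul, Real.norm_eq_abs, abs_of_pos hz]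
    ring
  · refine IntegrableOn.congr_fun ((expint_nat 1 hfx).const_mul (f x * D x u)) (fun z _ => ?_)
      measurableSet_Ioi
    simp only [map_smul, smul_eq_mul]
    ring

end part2
def Wt {d : ℕ} (γ : ℝ) (h : Euc d) : ℝ := min 1 (‖h‖ ^ 2) / ‖h‖ ^ ((d : ℝ) + γ)

section part3
variable {d : ℕ}

theorem euc_nontrivial (hd : 1 ≤ d) : Nontrivial (Euc d) := by
  have : Nonempty (Fin d) := ⟨⟨0, hd⟩⟩
  infer_instance

theorem pow_sub_one_mul_rpow (hd : 1 ≤ d) {y : ℝ} (hy : 0 < y) (q : ℝ) :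
    y ^ (d - 1) * y ^ q = y ^ ((d : ℝ) - 1 + q) := by
  rw [Real.rpow_add hy, ← Real.rpow_natCast, Nat.cast_sub hd, Nat.cast_one]

theorem tail_int (hd : 1 ≤ d) {q R : ℝ} (hq : 0 < q) (hR : 0 < R) :
    IntegrableOn (fun v : Euc d => ‖v‖ ^ (-((d : ℝ) + q))) {v | R ≤ ‖v‖} := by
  have := euc_nontrivial hd
  have hm : MeasurableSet {v : Euc d | R ≤ ‖v‖} := measurableSet_le measurable_const measurable_norm
  rw [← integrable_indicator_iff hm]
  have e : ({v : Euc d | R ≤ ‖v‖}.indicator fun v : Euc d => ‖v‖ ^ (-((d : ℝ) + q))) =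
      fun v : Euc d => ((Ici R).indicator fun r : ℝ => r ^ (-((d : ℝ) + q))) ‖v‖ := by
    ext v; simp [indicator]
  rw [e, integrable_fun_norm_addHaar volume]
  have h1 : IntegrableOn ((Ici R).indicator fun r : ℝ => r ^ (-1 - q)) (Ioi 0) := by
    apply IntegrableOn.integrable_indicator _ measurableSet_Ici |>.integrableOn
    rw [integrableOn_Ici_iff_integrableOn_Ioi]
    exact integrableOn_Ioi_rpow_of_lt (by linarith) hR
  refine h1.congr_fun (fun y hy => ?_) measurableSet_Ioi
  simp only [indicator, finrank_euclideanSpace, Fintype.card_fin, smul_eq_mul]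
  split_ifs
  · rw [pow_sub_one_mul_rpow hd hy]; ring_nf
  · simp

theorem Wt_int (hd : 1 ≤ d) {γ : ℝ} (h0 : 0 < γ) (h2 : γ < 2) :
    Integrable (fun h : Euc d => Wt γ h) := by
  have := euc_nontrivial hd
  unfold Wt
  rw [integrable_fun_norm_addHaar volume (f := fun r : ℝ => min 1 (r ^ 2) / r ^ ((d : ℝ) + γ))]
  have key : ∀ y : ℝ, 0 < y → y ^ (Module.finrank ℝ (Euc d) - 1) • (min 1 (y ^ 2) / y ^ ((d : ℝ) + γ))
      = min 1 (y ^ 2) * y ^ (-1 - γ) := by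
    intro y hy
    simp only [finrank_euclideanSpace, Fintype.card_fin, smul_eq_mul]
    rw [div_eq_mul_inv, ← Real.rpow_neg hy.le, mul_left_comm, pow_sub_one_mul_rpow hd hy]
    ring_nf
  rw [← Ioc_union_Ioi_eq_Ioi (zero_le_one' ℝ)]
  apply IntegrableOn.union
  · have : IntegrableOn (fun y : ℝ => y ^ (1 - γ)) (Ioc 0 1) := by
      rw [← intervalIntegrable_iff_integrableOn_Ioc_of_le zero_le_one]
      exact intervalIntegral.intervalIntegrable_rpow' (by linarith)
    refine this.congr_fun (fun y hy => ?_) measurableSet_Ioc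
    rw [key y hy.1, min_eq_right (by have := hy.1; have := hy.2; nlinarith), ← Real.rpow_natCast,
      ← Real.rpow_add hy.1]
    push_cast; ring_nf
  · have : IntegrableOn (fun y : ℝ => y ^ (-1 - γ)) (Ioi 1) :=
      integrableOn_Ioi_rpow_of_lt (by linarith) one_pos
    refine this.congr_fun (fun y hy => ?_) measurableSet_Ioi
    have hy' : (1 : ℝ) < y := hy
    rw [key y (by linarith), min_eq_left (by nlinarith), one_mul]

theorem Wt_nonneg (γ : ℝ) (h : Euc d) : 0 ≤ Wt γ h := by unfold Wt; positivity

theorem omega_tendsto (hd : 1 ≤ d) {γ : ℝ} (h0 : 0 < γ) (h2 : γ < 2) :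
    Filter.Tendsto (fun δ : ℝ => ∫ h in Metric.ball (0 : Euc d) δ, Wt γ h)
      (nhdsWithin 0 (Ioi 0)) (nhds 0) := by
  have := euc_nontrivial hd
  simp_rw [← integral_indicator measurableSet_ball]
  suffices hs : Filter.Tendsto (fun δ : ℝ => ∫ h, (Metric.ball (0 : Euc d) δ).indicator
      (fun h => Wt γ h) h) (nhdsWithin 0 (Ioi 0)) (nhds (∫ h : Euc d, (0 : ℝ))) by
    simpa using hs
  refine tendsto_integral_filter_of_dominated_convergence (fun h : Euc d => Wt γ h) ?_ ?_
    (Wt_int hd h0 h2) ?_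
  · exact Filter.Eventually.of_forall fun δ =>
      (Wt_int hd h0 h2).aestronglyMeasurable.indicator measurableSet_ball
  · refine Filter.Eventually.of_forall fun δ => Filter.Eventually.of_forall fun h => ?_
    refine (norm_indicator_le_norm_self _ _).trans ?_
    rw [Real.norm_eq_abs, abs_of_nonneg (Wt_nonneg γ h)]
  · have : ∀ᵐ h : Euc d, h ≠ 0 := by
      simp [ae_iff]
    filter_upwards [this] with h hh
    apply tendsto_const_nhds.congr'
    have : ∀ᶠ δ : ℝ in nhdsWithin 0 (Ioi 0), δ < ‖h‖ :=
      nhdsWithin_le_nhds (Iio_mem_nhds (norm_pos_iff.2 hh))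
    filter_upwards [this] with δ hδ
    rw [indicator_of_notMem]
    simp [hδ.le]

theorem sym_lemma (hd : 1 ≤ d) {γ : ℝ} (h0 : 0 < γ) (h2 : γ < 2) {g : Euc d → ℝ} {C : ℝ}
    (hg : Measurable g) (hb : ∀ h, |g h| ≤ C) (hs : ∀ h, |g h + g (-h)| ≤ C * min 1 (‖h‖ ^ 2))
    {δ : ℝ} (hδ : 0 < δ) :
    |(∫ h in {h : Euc d | δ ≤ ‖h‖}, g h / ‖h‖ ^ ((d : ℝ) + γ)) -
      (1 / 2) * ∫ h : Euc d, (g h + g (-h)) / ‖h‖ ^ ((d : ℝ) + γ)| ≤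
      C * ∫ h in Metric.ball (0 : Euc d) δ, Wt γ h := by
  set S := {h : Euc d | δ ≤ ‖h‖} with hS
  have hm : MeasurableSet S := measurableSet_le measurable_const measurable_norm
  have hI : IntegrableOn (fun h : Euc d => g h / ‖h‖ ^ ((d : ℝ) + γ)) S := by
    refine Integrable.mono' ((tail_int hd h0 hδ).const_mul C) ?_ ?_
    · exact (Measurable.aestronglyMeasurable (by fun_prop))
    · refine Filter.Eventually.of_forall fun h => ?_
      rw [Real.norm_eq_abs, abs_div, Real.rpow_neg (norm_nonneg _), div_eq_mul_inv,
        abs_of_nonneg (Real.rpow_nonneg (norm_nonneg _) _)]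
      exact mul_le_mul_of_nonneg_right (hb h) (by positivity)
  have hneg : ∀ G : Euc d → ℝ, ∫ h in S, G (-h) = ∫ h in S, G h := by
    intro G
    rw [← integral_indicator hm, ← integral_indicator hm, ← integral_neg_eq_self]
    congr 1
    ext h
    simp [indicator, hS]
  have hI' : IntegrableOn (fun h : Euc d => g (-h) / ‖h‖ ^ ((d : ℝ) + γ)) S := by
    have h1 := (integrable_indicator_iff hm).2 hI
    have h2 := h1.comp_neg
    rw [← integrable_indicator_iff hm]
    refine h2.congr (Filter.Eventually.of_forall fun h => ?_)
    simp [indicator, hS]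
  have e1 : ∫ h in S, (g h + g (-h)) / ‖h‖ ^ ((d : ℝ) + γ) =
      2 * ∫ h in S, g h / ‖h‖ ^ ((d : ℝ) + γ) := by
    have := hneg (fun h => g h / ‖h‖ ^ ((d : ℝ) + γ))
    simp only [norm_neg] at this
    simp_rw [add_div]
    rw [integral_add hI hI', this]; ring
  have hbd : ∀ h, ‖(g h + g (-h)) / ‖h‖ ^ ((d : ℝ) + γ)‖ ≤ C * Wt γ h := by
    intro h
    rw [Real.norm_eq_abs, abs_div, abs_of_nonneg (Real.rpow_nonneg (norm_nonneg h) _)]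
    unfold Wt
    rw [← mul_div_assoc]
    exact div_le_div_of_nonneg_right (hs h) (by positivity)
  have hT : Integrable (fun h : Euc d => (g h + g (-h)) / ‖h‖ ^ ((d : ℝ) + γ)) := by
    refine Integrable.mono' ((Wt_int hd h0 h2).const_mul C) ?_ (Filter.Eventually.of_forall hbd)
    exact (Measurable.aestronglyMeasurable (by fun_prop))
  have e2 := integral_add_compl hm hT
  have hSc : Sᶜ = Metric.ball (0 : Euc d) δ := by
    ext h; simp [hS]
  rw [e1, hSc] at e2
  have e3 : (∫ h in S, g h / ‖h‖ ^ ((d : ℝ) + γ)) -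
      (1 / 2) * ∫ h : Euc d, (g h + g (-h)) / ‖h‖ ^ ((d : ℝ) + γ) =
      -(1 / 2) * ∫ h in Metric.ball (0 : Euc d) δ, (g h + g (-h)) / ‖h‖ ^ ((d : ℝ) + γ) := by
    rw [← e2]; ring
  rw [e3, abs_mul, ← integral_const_mul]
  have h3 : |∫ h in Metric.ball (0 : Euc d) δ, (g h + g (-h)) / ‖h‖ ^ ((d : ℝ) + γ)| ≤
      ∫ h in Metric.ball (0 : Euc d) δ, C * Wt γ h := by
    rw [← Real.norm_eq_abs]
    exact norm_integral_le_of_norm_le ((Wt_int hd h0 h2).const_mul C).integrableOn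
      (Filter.Eventually.of_forall hbd)
  have h4 : |(-(1 / 2) : ℝ)| = 1 / 2 := by norm_num [abs_of_neg]
  rw [h4]
  have := abs_nonneg (∫ h in Metric.ball (0 : Euc d) δ, (g h + g (-h)) / ‖h‖ ^ ((d : ℝ) + γ))
  linarith

end part3
section part4
variable {d : ℕ}

theorem polar_integral (G : Euc d → ℝ) (hG : Integrable G) (hd : 1 ≤ d) :
    ∫ v, G v = ∫ θ : Metric.sphere (0 : Euc d) 1, (∫ r in Ioi (0 : ℝ), r ^ (d - 1) * G (r • (θ : Euc d)))
      ∂(volume : Measure (Euc d)).toSphere := by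
  have := euc_nontrivial hd
  have hmp := (volume : Measure (Euc d)).measurePreserving_homeomorphUnitSphereProd
  have he : MeasurableEmbedding (homeomorphUnitSphereProd (Euc d)) :=
    Homeomorph.measurableEmbedding _
  let G' : Metric.sphere (0 : Euc d) 1 × Ioi (0 : ℝ) → ℝ := fun q => G ((q.2 : ℝ) • (q.1 : Euc d))
  have hG' : ∀ x : ({0}ᶜ : Set (Euc d)), G' (homeomorphUnitSphereProd (Euc d) x) = G x := by
    intro x
    have h1 : ‖(x : Euc d)‖ ≠ 0 := norm_ne_zero_iff.2 x.2
    simp [G', smul_smul, h1]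
  have hmz : MeasurableSet ({0}ᶜ : Set (Euc d)) := (measurableSet_singleton _).compl
  have hGint : Integrable G' ((volume : Measure (Euc d)).toSphere.prod
      (Measure.volumeIoiPow (Module.finrank ℝ (Euc d) - 1))) := by
    rw [← hmp.integrable_comp_emb he]
    have : (G' ∘ homeomorphUnitSphereProd (Euc d)) = G ∘ Subtype.val := funext hG'
    rw [this, ← integrableOn_iff_comap_subtypeVal hmz]
    exact hG.integrableOn
  calc ∫ v, G v = ∫ x : ({(0)}ᶜ : Set (Euc d)), G x.1 ∂(Measure.comap Subtype.val volume) := by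
        rw [integral_subtype_comap hmz G, restrict_compl_singleton]
    _ = ∫ q, G' q ∂((volume : Measure (Euc d)).toSphere.prod
      (Measure.volumeIoiPow (Module.finrank ℝ (Euc d) - 1))) := by
        rw [← hmp.integral_comp he]
        simp only [hG']
    _ = ∫ θ, (∫ r, G' (θ, r) ∂(Measure.volumeIoiPow (Module.finrank ℝ (Euc d) - 1)))
          ∂(volume : Measure (Euc d)).toSphere := integral_prod _ hGint
    _ = _ := by
      congr 1
      ext θ
      simp only [Measure.volumeIoiPow, ENNReal.ofReal, finrank_euclideanSpace, Fintype.card_fin]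
      rw [integral_withDensity_eq_integral_smul]
      · simp only [G']
        rw [integral_subtype_comap measurableSet_Ioi
          (fun a : ℝ => Real.toNNReal (a ^ (d - 1)) • G (a • (θ : Euc d)))]
        refine setIntegral_congr_fun measurableSet_Ioi fun x hx => ?_
        simp only [NNReal.smul_def, Real.coe_toNNReal _ (pow_nonneg (mem_Ioi.1 hx).le _), smul_eq_mul]
      · exact (measurable_subtype_coe.pow_const _).real_toNNReal

theorem cv_1d {p γ ε R : ℝ} (hp : 0 < p) (hε : 0 < ε) (hR : 0 < R) (g : ℝ → ℝ) :
    ∫ r in Ioi (0 : ℝ), (Ici R).indicator (fun r => r ^ (-1 - p * γ) * g (ε * r ^ p)) r =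
    ε ^ γ / p * ∫ r in Ioi (0 : ℝ), (Ici (ε * R ^ p)).indicator (fun r => r ^ (-1 - γ) * g r) r := by
  have h1 := integral_comp_mul_left_Ioi
    ((Ici (ε * R ^ p)).indicator (fun r => r ^ (-1 - γ) * g r)) 0 hε
  have h2 := integral_comp_rpow_Ioi (fun r => (Ici (ε * R ^ p)).indicator
    (fun r => r ^ (-1 - γ) * g r) (ε * r)) hp.ne'
  rw [mul_zero] at h1
  rw [h1] at h2
  have h3 : ∫ r in Ioi (0 : ℝ), (Ici (ε * R ^ p)).indicator (fun r => r ^ (-1 - γ) * g r) r =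
     ε * ∫ x in Ioi (0 : ℝ), (|p| * x ^ (p - 1)) • (Ici (ε * R ^ p)).indicator
        (fun r => r ^ (-1 - γ) * g r) (ε * x ^ p) := by
    rw [h2, smul_eq_mul, mul_inv_cancel_left₀ hε.ne']
  rw [h3, ← mul_assoc, ← integral_const_mul]
  refine setIntegral_congr_fun measurableSet_Ioi fun x hx => ?_
  have hx' : (0 : ℝ) < x := hx
  have hmem : x ∈ Ici R ↔ ε * x ^ p ∈ Ici (ε * R ^ p) := by
    simp only [mem_Ici]
    rw [mul_le_mul_iff_right₀ hε, Real.rpow_le_rpow_iff hR.le hx'.le hp]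
  simp only [indicator]
  by_cases hxR : x ∈ Ici R
  · rw [if_pos hxR, if_pos (hmem.1 hxR)]
    rw [smul_eq_mul, abs_of_pos hp, Real.mul_rpow hε.le (by positivity), ← Real.rpow_mul hx'.le]
    have a1 : ε ^ γ * ε * ε ^ (-1 - γ) = 1 := by
      nth_rewrite 2 [← Real.rpow_one ε]
      rw [← Real.rpow_add hε, ← Real.rpow_add hε]; ring_nf; simp
    have a2 : x ^ (p - 1) * x ^ (p * (-1 - γ)) = x ^ (-1 - p * γ) := by
      rw [← Real.rpow_add hx']; ring_nf
    calc x ^ (-1 - p * γ) * g (ε * x ^ p)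
        = (ε ^ γ * ε * ε ^ (-1 - γ)) * (p / p) * (x ^ (p - 1) * x ^ (p * (-1 - γ))) *
            g (ε * x ^ p) := by rw [a1, a2, div_self hp.ne']; ring
      _ = _ := by ring
  · rw [if_neg hxR, if_neg (fun h => hxR (hmem.2 h))]
    simp

theorem cv_lemma (hd : 1 ≤ d) {α β γ ε R C : ℝ} (hαβ : β < α) (hβ : β < 1)
    (hγ : γ = (α - β) / (1 - β)) (hε : 0 < ε) (hR : 0 < R) {g : Euc d → ℝ} (hg : Measurable g)
    (hb : ∀ w, |g w| ≤ C) :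
    ∫ v in {v : Euc d | R ≤ ‖v‖}, ‖v‖ ^ (-((d : ℝ) + (α - β))) * g ((ε * ‖v‖ ^ (-β)) • v) =
    ε ^ γ / (1 - β) * ∫ w in {w : Euc d | ε * R ^ (1 - β) ≤ ‖w‖}, g w / ‖w‖ ^ ((d : ℝ) + γ) := by
  have hp : 0 < 1 - β := by linarith
  have hγ0 : 0 < γ := by rw [hγ]; exact div_pos (by linarith) hp
  have hpγ : (1 - β) * γ = α - β := by rw [hγ]; field_simp
  have hm : ∀ R : ℝ, MeasurableSet {v : Euc d | R ≤ ‖v‖} := fun R =>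
    measurableSet_le measurable_const measurable_norm
  have hR' : 0 < ε * R ^ (1 - β) := by positivity
  have i1 : IntegrableOn (fun v : Euc d => ‖v‖ ^ (-((d : ℝ) + (α - β))) * g ((ε * ‖v‖ ^ (-β)) • v))
      {v : Euc d | R ≤ ‖v‖} := by
    refine Integrable.mono' ((tail_int hd (q := α - β) (by linarith) hR).const_mul C) ?_ ?_
    · exact (Measurable.aestronglyMeasurable (by fun_prop))
    · refine Filter.Eventually.of_forall fun h => ?_
      rw [Real.norm_eq_abs, abs_mul, abs_of_nonneg (Real.rpow_nonneg (norm_nonneg _) _), mul_comm]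
      exact mul_le_mul_of_nonneg_right (hb _) (by positivity)
  have i2 : IntegrableOn (fun w : Euc d => g w / ‖w‖ ^ ((d : ℝ) + γ))
      {w : Euc d | ε * R ^ (1 - β) ≤ ‖w‖} := by
    refine Integrable.mono' ((tail_int hd hγ0 hR').const_mul C) ?_ ?_
    · exact (Measurable.aestronglyMeasurable (by fun_prop))
    · refine Filter.Eventually.of_forall fun h => ?_
      rw [Real.norm_eq_abs, abs_div, Real.rpow_neg (norm_nonneg _), div_eq_mul_inv,
        abs_of_nonneg (Real.rpow_nonneg (norm_nonneg _) _)]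
      exact mul_le_mul_of_nonneg_right (hb h) (by positivity)
  rw [← integral_indicator (hm _), ← integral_indicator (hm _),
    polar_integral _ ((integrable_indicator_iff (hm _)).2 i1) hd,
    polar_integral _ ((integrable_indicator_iff (hm _)).2 i2) hd, ← integral_const_mul]
  congr 1
  ext θ
  have hθ : ‖(θ : Euc d)‖ = 1 := by simp
  have := cv_1d (γ := γ) hp hε hR (fun r => g (r • (θ : Euc d)))
  have hn : ∀ r : ℝ, 0 < r → ‖r • (θ : Euc d)‖ = r := by
    intro r hr
    rw [norm_smul, hθ, mul_one, Real.norm_eq_abs, abs_of_pos hr]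
  have c1 : ∫ r in Ioi (0 : ℝ), r ^ (d - 1) * {v : Euc d | R ≤ ‖v‖}.indicator
      (fun v => ‖v‖ ^ (-((d : ℝ) + (α - β))) * g ((ε * ‖v‖ ^ (-β)) • v)) (r • (θ : Euc d)) =
      ∫ r in Ioi (0 : ℝ), (Ici R).indicator
        (fun r => r ^ (-1 - (1 - β) * γ) * g ((ε * r ^ (1 - β)) • (θ : Euc d))) r := by
    refine setIntegral_congr_fun measurableSet_Ioi fun r hr => ?_
    have hr' : 0 < r := hr
    simp only [indicator, mem_ofPred_eq, hn r hr', mem_Ici]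
    split_ifs
    · rw [← mul_assoc, pow_sub_one_mul_rpow hd hr', hpγ, smul_smul, mul_assoc ε,
        Real.rpow_sub hr' 1 β, Real.rpow_neg hr'.le, Real.rpow_one]
      congr 1
      · congr 1; ring
      · congr 3; rw [div_eq_mul_inv, mul_comm]
    · simp
  have c2 : ∫ r in Ioi (0 : ℝ), r ^ (d - 1) * {w : Euc d | ε * R ^ (1 - β) ≤ ‖w‖}.indicator
      (fun w => g w / ‖w‖ ^ ((d : ℝ) + γ)) (r • (θ : Euc d)) =
      ∫ r in Ioi (0 : ℝ), (Ici (ε * R ^ (1 - β))).indicator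
        (fun r => r ^ (-1 - γ) * g (r • (θ : Euc d))) r := by
    refine setIntegral_congr_fun measurableSet_Ioi fun r hr => ?_
    have hr' : 0 < r := hr
    simp only [indicator, mem_ofPred_eq, hn r hr', mem_Ici]
    split_ifs
    · rw [div_eq_mul_inv, ← Real.rpow_neg hr'.le, mul_comm (g _), ← mul_assoc,
        pow_sub_one_mul_rpow hd hr']
      congr 2; ring
    · simp
  rw [c1, c2, this]

end part4
def Gf {d : ℕ} (f ψ : Euc d → ℝ) (x w : Euc d) : ℝ :=
  ∫ z in Ioi (0 : ℝ), kk f ψ x z (z • w)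

def Kf {d : ℕ} (f ψ : Euc d → ℝ) (γ : ℝ) (x h : Euc d) : ℝ :=
  f x * ∫ z in Ioi (0 : ℝ), z ^ γ * kk f ψ x z h

def J1 (γ m : ℝ) : ℝ := ∫ z in Ioi (0 : ℝ), z ^ γ * ((1 + z) * Real.exp (-(z * m)))
def J2 (m : ℝ) : ℝ := ∫ z in Ioi (0 : ℝ), (1 + z ^ 2) * ((1 + z) * Real.exp (-(z * m)))

section part5
variable {d : ℕ} {f ψ : Euc d → ℝ} {m1 m2 l M C1 C2 γ : ℝ} {D : Euc d → Euc d →L[ℝ] ℝ}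

theorem J1_int {m : ℝ} (hγ : 0 < γ) (hm : 0 < m) :
    IntegrableOn (fun z : ℝ => z ^ γ * ((1 + z) * Real.exp (-(z * m)))) (Ioi 0) := by
  refine ((expint (a := γ) (by linarith) hm).add
    (expint (a := γ + 1) (by linarith) hm)).congr_fun (fun z hz => ?_) measurableSet_Ioi
  simp only [Pi.add_apply]
  rw [Real.rpow_add hz, Real.rpow_one]
  ring

theorem J2_int {m : ℝ} (hm : 0 < m) :
    IntegrableOn (fun z : ℝ => (1 + z ^ 2) * ((1 + z) * Real.exp (-(z * m)))) (Ioi 0) := by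
  refine (((expint_nat 0 hm).add (expint_nat 1 hm)).add (quadint hm)).congr_fun
    (fun z hz => ?_) measurableSet_Ioi
  simp only [Pi.add_apply]
  ring

theorem J1_nonneg (γ m : ℝ) : 0 ≤ J1 γ m := by
  refine setIntegral_nonneg measurableSet_Ioi fun z hz => ?_
  have : (0 : ℝ) < z := hz
  positivity

theorem J2_nonneg (m : ℝ) : 0 ≤ J2 m := by
  refine setIntegral_nonneg measurableSet_Ioi fun z hz => ?_
  have : (0 : ℝ) < z := hz
  positivity

theorem etaKer_eq (f ψ : Euc d → ℝ) (γ : ℝ) (x h : Euc d) :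
    etaKer f γ x (x + h) * (ψ (x + h) - ψ x) = Kf f ψ γ x h := by
  have e : ∫ s in (0 : ℝ)..1, f (s • x + (1 - s) • (x + h)) = ∫ s in (0 : ℝ)..1, f (x + s • h) := by
    have := intervalIntegral.integral_comp_sub_left (a := 0) (b := 1)
      (fun s : ℝ => f (x + s • h)) (1 : ℝ)
    simp only [sub_self, sub_zero] at this
    rw [← this]
    congr 1
    ext s
    congr 1
    module
  unfold etaKer Kf kk pk
  rw [e]
  have e2 : ∀ z : ℝ, z ^ γ * (f (x + h) * Real.exp (-(z * ∫ s in (0 : ℝ)..1, f (x + s • h))) *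
      (ψ (x + h) - ψ x)) = (f (x + h) * (ψ (x + h) - ψ x)) *
      (z ^ γ * Real.exp (-(z * ∫ s in (0 : ℝ)..1, f (x + s • h)))) := by
    intro z; ring
  simp_rw [e2]
  rw [integral_const_mul]
  ring

theorem min_scale (z a : ℝ) : min 1 ((z * a) ^ 2) ≤ (1 + z ^ 2) * min 1 (a ^ 2) := by
  rcases min_choice 1 (a ^ 2) with hm | hm <;> rw [hm]
  · exact (min_le_left _ _).trans (by nlinarith [sq_nonneg z])
  · exact (min_le_right _ _).trans (by nlinarith [sq_nonneg a])

theorem ss_bd' (hf : NuOK f m1 m2 l) (hψ : PsiOK ψ D M C1 C2) (x w : Euc d) {z : ℝ} (hz : 0 ≤ z) :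
    |ss f ψ x z (z • w)| ≤ (2 * Kc m2 l M C1 C2) *
      ((1 + z ^ 2) * ((1 + z) * Real.exp (-(z * m1)))) * min 1 (‖w‖ ^ 2) := by
  have hK := Kc_nonneg hf hψ
  refine (ss_bd hf hψ x (z • w) hz).trans ?_
  rw [norm_smul, Real.norm_eq_abs, abs_of_nonneg hz]
  calc _ ≤ 2 * Kc m2 l M C1 C2 * ((1 + z) * Real.exp (-(z * m1))) *
        ((1 + z ^ 2) * min 1 (‖w‖ ^ 2)) := by
        gcongr
        exact min_scale z ‖w‖
    _ = _ := by ring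

theorem kk_meas (hf : NuOK f m1 m2 l) (hψ : PsiOK ψ D M C1 C2) (x : Euc d) :
    Measurable (fun q : ℝ × Euc d => kk f ψ x q.1 q.2) := (kk_cont hf hψ.cont x).measurable

theorem Gf_meas (hf : NuOK f m1 m2 l) (hψ : PsiOK ψ D M C1 C2) (x : Euc d) :
    Measurable (Gf f ψ x) := by
  have h1 : Measurable (fun q : Euc d × ℝ => kk f ψ x q.2 (q.2 • q.1)) :=
    (kk_meas hf hψ x).comp (g := fun q : ℝ × Euc d => kk f ψ x q.1 q.2)
      (f := fun q : Euc d × ℝ => (q.2, q.2 • q.1)) (by fun_prop)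
  exact (h1.stronglyMeasurable.integral_prod_right' (ν := volume.restrict (Ioi (0 : ℝ)))).measurable

theorem Kf_meas (hf : NuOK f m1 m2 l) (hψ : PsiOK ψ D M C1 C2) (x : Euc d) :
    Measurable (Kf f ψ γ x) := by
  have h1 : Measurable (fun q : Euc d × ℝ => kk f ψ x q.2 q.1) :=
    (kk_meas hf hψ x).comp (g := fun q : ℝ × Euc d => kk f ψ x q.1 q.2)
      (f := fun q : Euc d × ℝ => (q.2, q.1)) (by fun_prop)
  have h2 : Measurable (fun q : Euc d × ℝ => q.2 ^ γ * kk f ψ x q.2 q.1) := by fun_prop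
  exact ((h2.stronglyMeasurable.integral_prod_right'
    (ν := volume.restrict (Ioi (0 : ℝ)))).measurable).const_mul _

theorem ae_Ioi {P : ℝ → Prop} (h : ∀ z : ℝ, 0 < z → P z) :
    ∀ᵐ z ∂(volume.restrict (Ioi (0 : ℝ))), P z :=
  (ae_restrict_iff' measurableSet_Ioi).2 (Filter.Eventually.of_forall fun z hz => h z hz)

theorem kk_bd' (hf : NuOK f m1 m2 l) (hψ : PsiOK ψ D M C1 C2) (x h : Euc d) {z : ℝ} (hz : 0 ≤ z) :
    |kk f ψ x z h| ≤ 2 * Kc m2 l M C1 C2 * ((1 + z) * Real.exp (-(z * m1))) := by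
  have hK := Kc_nonneg hf hψ
  refine (kk_bd hf hψ x h hz).trans ?_
  have : 0 ≤ Kc m2 l M C1 C2 * Real.exp (-(z * m1)) * (1 + 2 * z) := by positivity
  linarith

theorem Kint (hf : NuOK f m1 m2 l) (hψ : PsiOK ψ D M C1 C2) (hγ : 0 < γ) (x h : Euc d) :
    IntegrableOn (fun z : ℝ => z ^ γ * kk f ψ x z h) (Ioi 0) := by
  refine Integrable.mono' ((J1_int hγ hf.pos).const_mul (2 * Kc m2 l M C1 C2)) ?_ (ae_Ioi ?_)
  · have := (kk_meas hf hψ x).comp (g := fun q : ℝ × Euc d => kk f ψ x q.1 q.2)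
      (f := fun z : ℝ => (z, h)) (by fun_prop)
    simp only [Function.comp_def] at this
    exact Measurable.aestronglyMeasurable (by fun_prop)
  · intro z hz
    rw [norm_mul, Real.norm_eq_abs, Real.norm_eq_abs, abs_of_nonneg (Real.rpow_nonneg hz.le _)]
    have := mul_le_mul_of_nonneg_left (kk_bd' hf hψ x h hz.le) (Real.rpow_nonneg hz.le γ)
    linarith

theorem Kf_bd (hf : NuOK f m1 m2 l) (hψ : PsiOK ψ D M C1 C2) (hγ : 0 < γ) (x h : Euc d) :
    |Kf f ψ γ x h| ≤ m2 * (2 * Kc m2 l M C1 C2 * J1 γ m1) := by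
  unfold Kf
  rw [abs_mul, abs_of_pos (hf.pos.trans_le (hf.lo x))]
  refine mul_le_mul (hf.hi x) ?_ (abs_nonneg _) hf.m2pos.le
  unfold J1
  rw [← integral_const_mul, ← Real.norm_eq_abs]
  refine norm_integral_le_of_norm_le ((J1_int hγ hf.pos).const_mul _) (ae_Ioi ?_)
  intro z hz
  rw [norm_mul, Real.norm_eq_abs, Real.norm_eq_abs, abs_of_nonneg (Real.rpow_nonneg hz.le _)]
  have := mul_le_mul_of_nonneg_left (kk_bd' hf hψ x h hz.le) (Real.rpow_nonneg hz.le γ)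
  linarith

theorem Kf_sym (hf : NuOK f m1 m2 l) (hψ : PsiOK ψ D M C1 C2) (hγ : 0 < γ) (x h : Euc d) :
    Kf f ψ γ x h + Kf f ψ γ x (-h) = f x * ∫ z in Ioi (0 : ℝ), z ^ γ * ss f ψ x z h := by
  unfold Kf ss
  simp_rw [mul_add]
  rw [integral_add (Kint hf hψ hγ x h) (Kint hf hψ hγ x (-h))]
  ring

theorem Kf_sym_bd (hf : NuOK f m1 m2 l) (hψ : PsiOK ψ D M C1 C2) (hγ : 0 < γ) (x h : Euc d) :
    |Kf f ψ γ x h + Kf f ψ γ x (-h)| ≤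
      m2 * (2 * Kc m2 l M C1 C2 * J1 γ m1) * min 1 (‖h‖ ^ 2) := by
  rw [Kf_sym hf hψ hγ, abs_mul, abs_of_pos (hf.pos.trans_le (hf.lo x)), mul_assoc m2]
  refine mul_le_mul (hf.hi x) ?_ (abs_nonneg _) hf.m2pos.le
  unfold J1
  rw [← integral_const_mul, ← integral_mul_const, ← Real.norm_eq_abs]
  refine norm_integral_le_of_norm_le (((J1_int hγ hf.pos).const_mul _).mul_const _) (ae_Ioi ?_)
  intro z hz
  rw [norm_mul, Real.norm_eq_abs, Real.norm_eq_abs, abs_of_nonneg (Real.rpow_nonneg hz.le _)]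
  have := mul_le_mul_of_nonneg_left (ss_bd hf hψ x h hz.le) (Real.rpow_nonneg hz.le γ)
  linarith

theorem Gf_bd (hf : NuOK f m1 m2 l) (hψ : PsiOK ψ D M C1 C2) (x w : Euc d) :
    |Gf f ψ x w| ≤ 2 * Kc m2 l M C1 C2 * J2 m1 := by
  have hK := Kc_nonneg hf hψ
  unfold Gf J2
  rw [← integral_const_mul, ← Real.norm_eq_abs]
  refine norm_integral_le_of_norm_le ((J2_int hf.pos).const_mul _) (ae_Ioi ?_)
  intro z hz
  refine (kk_bd' hf hψ x (z • w) hz.le).trans ?_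
  have : 0 ≤ 2 * Kc m2 l M C1 C2 * ((1 + z) * Real.exp (-(z * m1))) * z ^ 2 := by positivity
  linarith

theorem Gf_sym (hf : NuOK f m1 m2 l) (hψ : PsiOK ψ D M C1 C2) (x w : Euc d) :
    Gf f ψ x w + Gf f ψ x (-w) = ∫ z in Ioi (0 : ℝ), ss f ψ x z (z • w) := by
  unfold Gf ss
  rw [← integral_add (kk_int hf hψ x w) (kk_int hf hψ x (-w))]
  simp only [smul_neg]

theorem Gf_sym_bd (hf : NuOK f m1 m2 l) (hψ : PsiOK ψ D M C1 C2) (x w : Euc d) :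
    |Gf f ψ x w + Gf f ψ x (-w)| ≤ 2 * Kc m2 l M C1 C2 * J2 m1 * min 1 (‖w‖ ^ 2) := by
  rw [Gf_sym hf hψ]
  unfold J2
  rw [← integral_const_mul, ← integral_mul_const, ← Real.norm_eq_abs]
  refine norm_integral_le_of_norm_le (((J2_int hf.pos).const_mul _).mul_const _) (ae_Ioi ?_)
  intro z hz
  exact ss_bd' hf hψ x w hz.le

theorem main_identity (hd : 1 ≤ d) (hf : NuOK f m1 m2 l) (hψ : PsiOK ψ D M C1 C2) (hγ : 0 < γ)
    (hγ2 : γ < 2) (x : Euc d) :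
    ∫ h : Euc d, (Kf f ψ γ x h + Kf f ψ γ x (-h)) / ‖h‖ ^ ((d : ℝ) + γ) =
    f x * ∫ w : Euc d, (Gf f ψ x w + Gf f ψ x (-w)) / ‖w‖ ^ ((d : ℝ) + γ) := by
  have hm := (ss_cont hf hψ.cont x).measurable
  have hW := Wt_int (d := d) hd hγ hγ2
  -- first product integrability
  have p1 : Integrable (Function.uncurry fun (z : ℝ) (h : Euc d) =>
      z ^ γ * ss f ψ x z h / ‖h‖ ^ ((d : ℝ) + γ)) ((volume.restrict (Ioi (0 : ℝ))).prod volume) := by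
    refine Integrable.mono' (((J1_int hγ hf.pos).const_mul (2 * Kc m2 l M C1 C2)).mul_prod hW) ?_ ?_
    · simp only [Function.uncurry_def]
      exact Measurable.aestronglyMeasurable (by fun_prop)
    · have : ∀ᵐ q ∂((volume.restrict (Ioi (0 : ℝ))).prod (volume : Measure (Euc d))), 0 < q.1 := by
        have := (Measure.quasiMeasurePreserving_fst (μ := volume.restrict (Ioi (0 : ℝ)))
          (ν := (volume : Measure (Euc d)))).ae (ae_Ioi (P := fun z => 0 < z) fun z hz => hz)
        exact this
      filter_upwards [this] with q hq
      simp only [Function.uncurry_def, Wt]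
      rw [norm_div, norm_mul, Real.norm_eq_abs, Real.norm_eq_abs, Real.norm_eq_abs,
        abs_of_nonneg (Real.rpow_nonneg hq.le _), abs_of_nonneg (Real.rpow_nonneg (norm_nonneg _) _),
        ← mul_div_assoc]
      refine div_le_div_of_nonneg_right ?_ (by positivity)
      have := mul_le_mul_of_nonneg_left (ss_bd hf hψ x q.2 hq.le) (Real.rpow_nonneg hq.le γ)
      linarith
  have p2 : Integrable (Function.uncurry fun (z : ℝ) (h : Euc d) =>
      ss f ψ x z (z • h) / ‖h‖ ^ ((d : ℝ) + γ)) ((volume.restrict (Ioi (0 : ℝ))).prod volume) := by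
    refine Integrable.mono' (((J2_int hf.pos).const_mul (2 * Kc m2 l M C1 C2)).mul_prod hW) ?_ ?_
    · have hm2 := hm.comp (f := fun q : ℝ × Euc d => (q.1, q.1 • q.2)) (by fun_prop)
      simp only [Function.comp_def] at hm2
      simp only [Function.uncurry_def]
      exact Measurable.aestronglyMeasurable (by fun_prop)
    · have : ∀ᵐ q ∂((volume.restrict (Ioi (0 : ℝ))).prod (volume : Measure (Euc d))), 0 < q.1 := by
        have := (Measure.quasiMeasurePreserving_fst (μ := volume.restrict (Ioi (0 : ℝ)))
          (ν := (volume : Measure (Euc d)))).ae (ae_Ioi (P := fun z => 0 < z) fun z hz => hz)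
        exact this
      filter_upwards [this] with q hq
      simp only [Function.uncurry_def, Wt]
      rw [norm_div, Real.norm_eq_abs, Real.norm_eq_abs,
        abs_of_nonneg (Real.rpow_nonneg (norm_nonneg _) _), ← mul_div_assoc]
      refine div_le_div_of_nonneg_right ?_ (by positivity)
      exact ss_bd' hf hψ x q.2 hq.le
  have s1 := integral_integral_swap p1
  have s2 := integral_integral_swap p2
  have e : ∀ z : ℝ, 0 < z → ∫ h : Euc d, z ^ γ * ss f ψ x z h / ‖h‖ ^ ((d : ℝ) + γ) =
      ∫ h : Euc d, ss f ψ x z (z • h) / ‖h‖ ^ ((d : ℝ) + γ) := by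
    intro z hz
    have := Measure.integral_comp_smul (volume : Measure (Euc d))
      (fun h => z ^ γ * ss f ψ x z h / ‖h‖ ^ ((d : ℝ) + γ)) z
    rw [finrank_euclideanSpace, Fintype.card_fin, abs_of_pos (by positivity), smul_eq_mul] at this
    have h3 : ∫ h : Euc d, z ^ γ * ss f ψ x z h / ‖h‖ ^ ((d : ℝ) + γ) =
      z ^ d * ∫ h : Euc d, z ^ γ * ss f ψ x z (z • h) / ‖z • h‖ ^ ((d : ℝ) + γ) := by
      rw [this, ← mul_assoc, mul_inv_cancel₀ (by positivity), one_mul]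
    rw [h3, ← integral_const_mul]
    congr 1
    ext h
    rw [norm_smul, Real.norm_eq_abs, abs_of_pos hz, Real.mul_rpow hz.le (norm_nonneg _),
      Real.rpow_add hz, Real.rpow_natCast, div_eq_mul_inv, div_eq_mul_inv, mul_inv]
    have a1 : z ^ d ≠ 0 := by positivity
    have a2 : z ^ γ ≠ 0 := by positivity
    field_simp
  have e' : ∫ z in Ioi (0 : ℝ), ∫ h : Euc d, z ^ γ * ss f ψ x z h / ‖h‖ ^ ((d : ℝ) + γ) =
      ∫ z in Ioi (0 : ℝ), ∫ h : Euc d, ss f ψ x z (z • h) / ‖h‖ ^ ((d : ℝ) + γ) :=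
    setIntegral_congr_fun measurableSet_Ioi fun z hz => e z hz
  rw [s1, s2] at e'
  simp_rw [Kf_sym hf hψ hγ, Gf_sym hf hψ, mul_div_assoc]
  rw [integral_const_mul]
  simp_rw [integral_div] at e'
  rw [e']

end part5
section part6
variable {d : ℕ}

theorem psi_ok (φ : ℝ → Euc d → ℝ)
    (hφ : ContDiff ℝ (⊤ : ℕ∞) fun p : ℝ × Euc d => φ p.1 p.2)
    (hφc : HasCompactSupport fun p : ℝ × Euc d => φ p.1 p.2) :
    ∃ M C1 C2 : ℝ, ∀ t, PsiOK (φ t) (fun x => fderiv ℝ (fun y => φ t y) x) M C1 C2 := by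
  set Φ := fun p : ℝ × Euc d => φ p.1 p.2 with hΦ
  obtain ⟨M, hM⟩ := hφc.exists_bound_of_continuous hφ.continuous
  obtain ⟨C1, hC1⟩ := ContDiff.lipschitzWith_of_hasCompactSupport hφc hφ (by simp)
  have hd1 : ContDiff ℝ 1 (fderiv ℝ Φ) :=
    (hφ.of_le (m := 2) (by norm_cast)).fderiv_right (by norm_num)
  obtain ⟨C2, hC2⟩ := ContDiff.lipschitzWith_of_hasCompactSupport (hφc.fderiv ℝ) hd1 (by simp)
  have hdiff : Differentiable ℝ Φ := hφ.differentiable (by simp)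
  refine ⟨M, C1, C2, fun t => ?_⟩
  have hnorm : ∀ h : Euc d, ‖((0 : ℝ), h)‖ = ‖h‖ := fun h => by simp [Prod.norm_def]
  have hfd : ∀ x h, fderiv ℝ (fun y => φ t y) x h = fderiv ℝ Φ (t, x) (0, h) := by
    intro x h
    have h1 : HasFDerivAt (fun y : Euc d => (t, y)) (ContinuousLinearMap.inr ℝ ℝ (Euc d)) x :=
      hasFDerivAt_prodMk_right t x
    have h2 := (hdiff (t, x)).hasFDerivAt.comp x h1
    have h3 : fderiv ℝ (fun y => φ t y) x = _ := h2.fderiv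
    rw [h3]; rfl
  constructor
  · exact hφ.continuous.comp (g := Φ) (f := fun y => (t, y)) (by fun_prop)
  · intro y; exact hM (t, y)
  · exact C1.2
  · exact C2.2
  · intro x h
    have := hC1.norm_sub_le (t, x + h) (t, x)
    rw [Prod.mk_sub_mk, sub_self, add_sub_cancel_left, hnorm] at this
    exact this
  · intro x h
    rw [hfd]
    have := Convex.norm_image_sub_le_of_norm_hasFDerivWithin_le' (𝕜 := ℝ) (f := Φ)
      (f' := fderiv ℝ Φ) (φ := fderiv ℝ Φ (t, x)) (C := C2 * ‖h‖)
      (s := Metric.closedBall (t, x) ‖h‖) (x := (t, x)) (y := (t, x + h))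
      (fun p _ => (hdiff p).hasFDerivAt.hasFDerivWithinAt)
      (fun p hp => by
        refine (hC2.norm_sub_le p (t, x)).trans ?_
        rw [mem_closedBall_iff_norm] at hp
        gcongr) (convex_closedBall _ _) (by simp)
      (by rw [mem_closedBall_iff_norm, Prod.mk_sub_mk, sub_self, add_sub_cancel_left, hnorm])
    rw [Prod.mk_sub_mk, sub_self, add_sub_cancel_left, hnorm] at this
    rw [pow_two, ← mul_assoc]
    exact this

theorem lip_of_C1 {f : Euc d → ℝ} (hf : ContDiff ℝ 1 f) {C : ℝ} (hC : ∀ x, ‖fderiv ℝ f x‖ ≤ C)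
    (x y : Euc d) : |f y - f x| ≤ C * ‖y - x‖ :=
  Convex.norm_image_sub_le_of_norm_fderiv_le (𝕜 := ℝ) (f := f) (s := univ)
    (fun z _ => (hf.differentiable (by simp)) z) (fun z _ => hC z) convex_univ (mem_univ _)
    (mem_univ _)

theorem nu0_ok {ν₀ : Euc d → ℝ} {ν₁ ν₂ C : ℝ} (hν₁ : 0 < ν₁)
    (hν₀_icc : ∀ x, ν₀ x ∈ Set.Icc ν₁ ν₂)
    (hν₀_C1 : ContDiff ℝ 1 ν₀) (hC : ∀ x, ‖fderiv ℝ ν₀ x‖ ≤ C) : NuOK ν₀ ν₁ ν₂ C :=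
  ⟨hν₁, hν₀_C1.continuous, fun y => (hν₀_icc y).1, fun y => (hν₀_icc y).2,
    (norm_nonneg _).trans (hC 0), lip_of_C1 hν₀_C1 hC⟩

theorem rpow_between {s S b : ℝ} (h1 : 1 ≤ s) (h2 : s ≤ S) :
    min 1 (S ^ b) ≤ s ^ b ∧ s ^ b ≤ max 1 (S ^ b) := by
  rcases le_total 0 b with hb | hb
  · exact ⟨(min_le_left _ _).trans (Real.one_le_rpow h1 hb),
      (Real.rpow_le_rpow (by linarith) h2 hb).trans (le_max_right _ _)⟩
  · exact ⟨(min_le_right _ _).trans (Real.rpow_le_rpow_of_nonpos (by linarith) h2 hb),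
      (Real.rpow_le_one_of_one_le_of_nonpos h1 hb).trans (le_max_left _ _)⟩

theorem jfloor_between {R b : ℝ} (hR : 1 ≤ R) (v : Euc d) (hv : ‖v‖ ≤ R) :
    min 1 (R ^ b) ≤ jfloor b v ∧ jfloor b v ≤ max 1 (R ^ b) := by
  unfold jfloor
  split_ifs with h
  · exact ⟨min_le_left _ _, le_max_left _ _⟩
  · exact rpow_between (by linarith) hv

theorem jfloor_large {b : ℝ} (v : Euc d) (hv : 1 ≤ ‖v‖) : jfloor b v = ‖v‖ ^ b := by
  unfold jfloor
  split_ifs with h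
  · rw [le_antisymm h hv, Real.one_rpow]
  · rfl

theorem jfloor_pos {b : ℝ} (v : Euc d) : 0 < jfloor b v := by
  unfold jfloor
  split_ifs with h
  · exact one_pos
  · exact Real.rpow_pos_of_pos (by linarith) _

theorem jfloor_meas (b : ℝ) : Measurable (fun v : Euc d => jfloor b v) := by
  unfold jfloor
  exact Measurable.ite (measurableSet_le measurable_norm measurable_const) measurable_const
    (by fun_prop)

theorem bracket_between {R : ℝ} (v : Euc d) (hv : ‖v‖ ≤ R) :
    1 ≤ Real.sqrt (1 + ‖v‖ ^ 2) ∧ Real.sqrt (1 + ‖v‖ ^ 2) ≤ Real.sqrt (1 + R ^ 2) := by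
  constructor
  · rw [Real.one_le_sqrt]; nlinarith [sq_nonneg ‖v‖]
  · apply Real.sqrt_le_sqrt; gcongr

theorem nuv_ok {ν : Euc d → Euc d → ℝ} {β R ν₁ ν₂ C : ℝ} (hR : 1 ≤ R) (hν₁ : 0 < ν₁) (h12 : ν₁ ≤ ν₂)
    (hν_bound : ∀ x v, ν₁ * Real.sqrt (1 + ‖v‖ ^ 2) ^ β ≤ ν x v ∧
      ν x v ≤ ν₂ * Real.sqrt (1 + ‖v‖ ^ 2) ^ β)
    (hν_C1 : ∀ v, ContDiff ℝ 1 fun x => ν x v)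
    (hC : ∀ x v, Real.sqrt (1 + ‖v‖ ^ 2) ^ (-β) * ‖fderiv ℝ (fun y => ν y v) x‖ ≤ C)
    (v : Euc d) (hv : ‖v‖ ≤ R) :
    NuOK (fun y => jfloor (-β) v * ν y v)
      (min 1 (R ^ (-β)) * (ν₁ * min 1 (Real.sqrt (1 + R ^ 2) ^ β)))
      (max 1 (R ^ (-β)) * (ν₂ * max 1 (Real.sqrt (1 + R ^ 2) ^ β)))
      (max 1 (R ^ (-β)) * (C * max 1 (Real.sqrt (1 + R ^ 2) ^ β))) := by
  obtain ⟨b1, b2⟩ := bracket_between v hv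
  obtain ⟨c1, c2⟩ := rpow_between (b := β) b1 b2
  obtain ⟨a1, a2⟩ := jfloor_between (b := -β) hR v hv
  have hC0 : 0 ≤ C := (by positivity : (0 : ℝ) ≤ _).trans (hC 0 v)
  have hS : 0 < Real.sqrt (1 + R ^ 2) := by positivity
  have hs : 0 < Real.sqrt (1 + ‖v‖ ^ 2) := by positivity
  have hR0 : 0 < R := by linarith
  have hmin1 : 0 < min 1 (R ^ (-β)) := lt_min one_pos (by positivity)
  have hmin2 : 0 < min 1 (Real.sqrt (1 + R ^ 2) ^ β) := lt_min one_pos (by positivity)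
  have hj := jfloor_pos (b := -β) v
  have hν₂ : 0 < ν₂ := by linarith
  refine ⟨by positivity, continuous_const.mul (hν_C1 v).continuous, fun y => ?_, fun y => ?_,
    by positivity, ?_⟩
  · exact mul_le_mul a1 ((mul_le_mul_of_nonneg_left c1 hν₁.le).trans (hν_bound y v).1)
      (by positivity) hj.le
  · refine mul_le_mul a2 ((hν_bound y v).2.trans (mul_le_mul_of_nonneg_left c2 hν₂.le)) ?_
      (by positivity)
    exact le_trans (by positivity) (hν_bound y v).1
  · intro x y
    have h1 : ∀ x, ‖fderiv ℝ (fun y => ν y v) x‖ ≤ C * max 1 (Real.sqrt (1 + R ^ 2) ^ β) := by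
      intro x
      have h2 := hC x v
      have h3 : ‖fderiv ℝ (fun y => ν y v) x‖ ≤ C * Real.sqrt (1 + ‖v‖ ^ 2) ^ β := by
        rw [Real.rpow_neg hs.le] at h2
        have h4 : 0 < Real.sqrt (1 + ‖v‖ ^ 2) ^ β := by positivity
        rwa [inv_mul_le_iff₀ h4, mul_comm] at h2
      exact h3.trans (mul_le_mul_of_nonneg_left c2 hC0)
    have h5 := lip_of_C1 (hν_C1 v) h1 x y
    rw [← mul_sub, abs_mul, abs_of_pos hj, mul_assoc]
    exact mul_le_mul a2 h5 (abs_nonneg _) (by positivity)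

theorem chi_eq (ν : Euc d → Euc d → ℝ) (β : ℝ) (φ : ℝ → Euc d → ℝ) (ε t : ℝ) (x v : Euc d) :
    chiAux ν β φ ε t x v =
      Qf (fun y => jfloor (-β) v * ν y v) (φ t) x ((ε * jfloor (-β) v) • v) := by
  unfold chiAux Qf
  simp only [smul_smul]
  congr 1
  ext z
  simp only [mul_comm _ (ε * jfloor (-β) v)]

theorem chi_large {ν : Euc d → Euc d → ℝ} {ν₀ : Euc d → ℝ} {β R : ℝ} (hR : 1 ≤ R)
    (hν_eq : ∀ x v, R ≤ ‖v‖ → ν x v = ν₀ x * ‖v‖ ^ β)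
    (φ : ℝ → Euc d → ℝ) (ε t : ℝ) (x v : Euc d) (hv : R ≤ ‖v‖) :
    chiAux ν β φ ε t x v = Qf ν₀ (φ t) x ((ε * ‖v‖ ^ (-β)) • v) := by
  rw [chi_eq, jfloor_large v (by linarith)]
  have hv0 : 0 < ‖v‖ := by linarith
  have : (fun y => ‖v‖ ^ (-β) * ν y v) = ν₀ := by
    ext y
    rw [hν_eq y v hv, mul_left_comm, ← Real.rpow_add hv0]
    simp
  rw [this]

theorem chi_meas {ν : Euc d → Euc d → ℝ}
    (hν_meas : Measurable fun p : Euc d × Euc d => ν p.1 p.2) (β : ℝ) {φ : ℝ → Euc d → ℝ} (ε t : ℝ)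
    (hφ : Continuous (φ t)) (x : Euc d) :
    Measurable (fun v => chiAux ν β φ ε t x v) := by
  have hj := jfloor_meas (d := d) (-β)
  have hφm := hφ.measurable
  simp_rw [chi_eq]
  unfold Qf
  have hav : ∀ (v : Euc d) (z : ℝ),
      (∫ s in (0 : ℝ)..z, jfloor (-β) v * ν (x + s • ((ε * jfloor (-β) v) • v)) v) =
      z * ∫ s in (0 : ℝ)..1, jfloor (-β) v * ν (x + s • z • ((ε * jfloor (-β) v) • v)) v :=
    fun v z => avg_scale (fun y => jfloor (-β) v * ν y v) x _ z
  simp_rw [hav]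
  have hin : Measurable (fun q : (Euc d × ℝ) × ℝ =>
      jfloor (-β) q.1.1 * ν (x + q.2 • q.1.2 • ((ε * jfloor (-β) q.1.1) • q.1.1)) q.1.1) := by
    have h1 : Measurable (fun q : (Euc d × ℝ) × ℝ =>
      ν (x + q.2 • q.1.2 • ((ε * jfloor (-β) q.1.1) • q.1.1)) q.1.1) :=
      hν_meas.comp (g := fun p : Euc d × Euc d => ν p.1 p.2)
        (f := fun q : (Euc d × ℝ) × ℝ =>
          (x + q.2 • q.1.2 • ((ε * jfloor (-β) q.1.1) • q.1.1), q.1.1)) (by fun_prop)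
    fun_prop
  have hI : Measurable (fun q : Euc d × ℝ => ∫ s in (0 : ℝ)..1,
      jfloor (-β) q.1 * ν (x + s • q.2 • ((ε * jfloor (-β) q.1) • q.1)) q.1) := by
    simp_rw [intervalIntegral.integral_of_le (zero_le_one' ℝ)]
    exact (hin.stronglyMeasurable.integral_prod_right'
      (ν := volume.restrict (Ioc (0 : ℝ) 1))).measurable
  have hn : Measurable (fun q : Euc d × ℝ => ν (x + q.2 • ((ε * jfloor (-β) q.1) • q.1)) q.1) :=
    hν_meas.comp (g := fun p : Euc d × Euc d => ν p.1 p.2)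
        (f := fun q : Euc d × ℝ => (x + q.2 • ((ε * jfloor (-β) q.1) • q.1), q.1)) (by fun_prop)
  have htot : Measurable (fun q : Euc d × ℝ =>
      jfloor (-β) q.1 * ν (x + q.2 • ((ε * jfloor (-β) q.1) • q.1)) q.1 *
      Real.exp (-(q.2 * ∫ s in (0 : ℝ)..1,
        jfloor (-β) q.1 * ν (x + s • q.2 • ((ε * jfloor (-β) q.1) • q.1)) q.1)) *
      φ t (x + q.2 • ((ε * jfloor (-β) q.1) • q.1))) := by fun_prop
  exact (htot.stronglyMeasurable.integral_prod_right'
    (ν := volume.restrict (Ioi (0 : ℝ)))).measurable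

end part6
section part7

structure Hyp {d : ℕ} (α β γ κ R ν₁ ν₂ l0 m1 m2 l N A M C1 C2 : ℝ) (ν₀ : Euc d → ℝ)
    (ν : Euc d → Euc d → ℝ) (F : Euc d → ℝ) (φ : ℝ → Euc d → ℝ) : Prop where
  hd : 1 ≤ d
  hα : 0 < α
  hβ1 : β < 1
  hβα : β < α
  hγ : γ = (α - β) / (1 - β)
  hγ0 : 0 < γ
  hγ2 : γ < 2
  hR : 1 ≤ R
  f0 : NuOK ν₀ ν₁ ν₂ l0
  hν_meas : Measurable fun p : Euc d × Euc d => ν p.1 p.2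
  hν_pos : ∀ x v, 0 < ν x v
  hν_le : ∀ x v, ‖v‖ ≤ R → ν x v ≤ N
  hj_le : ∀ v : Euc d, ‖v‖ ≤ R → jfloor (-β) v ≤ A
  hν_eq : ∀ x v, R ≤ ‖v‖ → ν x v = ν₀ x * ‖v‖ ^ β
  hF_pos : ∀ v, 0 < F v
  hF_meas : Measurable F
  hF_int : Integrable F
  hF_mass : (∫ v, F v) = 1
  hF_eq : ∀ v : Euc d, R ≤ ‖v‖ → F v = κ * ‖v‖ ^ (-(α + (d : ℝ)))
  hκ : 0 < κ
  nuv : ∀ v : Euc d, ‖v‖ ≤ R → NuOK (fun y => jfloor (-β) v * ν y v) m1 m2 l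
  ps : ∀ t, PsiOK (φ t) (fun x => fderiv ℝ (fun y => φ t y) x) M C1 C2

theorem pv_lemma {d : ℕ} {f ψ : Euc d → ℝ} {m1 m2 l M C1 C2 γ : ℝ} {D : Euc d → Euc d →L[ℝ] ℝ}
    (hd : 1 ≤ d) (hf : NuOK f m1 m2 l) (hψ : PsiOK ψ D M C1 C2) (hγ : 0 < γ) (hγ2 : γ < 2)
    (x : Euc d) :
    Filter.Tendsto
      (fun δ : ℝ => ∫ y in {y : Euc d | δ ≤ ‖y - x‖},
        etaKer f γ x y * (ψ y - ψ x) / ‖x - y‖ ^ ((d : ℝ) + γ))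
      (nhdsWithin 0 (Set.Ioi 0))
      (nhds ((1 / 2) * ∫ h : Euc d, (Kf f ψ γ x h + Kf f ψ γ x (-h)) / ‖h‖ ^ ((d : ℝ) + γ))) := by
  have hT : ∀ δ : ℝ, (∫ y in {y : Euc d | δ ≤ ‖y - x‖},
        etaKer f γ x y * (ψ y - ψ x) / ‖x - y‖ ^ ((d : ℝ) + γ)) =
      ∫ h in {h : Euc d | δ ≤ ‖h‖}, Kf f ψ γ x h / ‖h‖ ^ ((d : ℝ) + γ) := by
    intro δ
    rw [← integral_indicator (measurableSet_le measurable_const (by fun_prop)),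
      ← integral_indicator (measurableSet_le measurable_const (by fun_prop)),
      ← integral_add_left_eq_self _ x]
    congr 1
    ext h
    simp only [indicator, mem_ofPred_eq, add_sub_cancel_left, sub_add_cancel_left, norm_neg,
      etaKer_eq]
  simp_rw [hT]
  rw [tendsto_iff_dist_tendsto_zero]
  have h0 := (omega_tendsto hd hγ hγ2).const_mul (m2 * (2 * Kc m2 l M C1 C2 * J1 γ m1))
  rw [mul_zero] at h0
  refine squeeze_zero' (Filter.Eventually.of_forall fun _ => dist_nonneg) ?_ h0
  filter_upwards [self_mem_nhdsWithin] with δ hδ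
  rw [Real.dist_eq]
  exact sym_lemma hd hγ hγ2 (Kf_meas hf hψ x) (Kf_bd hf hψ hγ x) (Kf_sym_bd hf hψ hγ x) hδ

variable {d : ℕ} {α β γ κ R ν₁ ν₂ l0 m1 m2 l N A M C1 C2 : ℝ} {ν₀ : Euc d → ℝ}
    {ν : Euc d → Euc d → ℝ} {F : Euc d → ℝ} {φ : ℝ → Euc d → ℝ}

def Pf {d : ℕ} (β : ℝ) (ν : Euc d → Euc d → ℝ) (F : Euc d → ℝ) (φ : ℝ → Euc d → ℝ) (ε t : ℝ)
    (x v : Euc d) : ℝ := ν x v * F v * (chiAux ν β φ ε t x v - φ t x)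

theorem meas_out (R : ℝ) : MeasurableSet {v : Euc d | R ≤ ‖v‖} :=
  measurableSet_le measurable_const measurable_norm

theorem compl_out (R : ℝ) : {v : Euc d | R ≤ ‖v‖}ᶜ = Metric.ball 0 R := by
  ext v; simp

theorem Pf_large (H : Hyp α β γ κ R ν₁ ν₂ l0 m1 m2 l N A M C1 C2 ν₀ ν F φ) (ε t : ℝ) (x v : Euc d)
    (hv : R ≤ ‖v‖) : Pf β ν F φ ε t x v = κ * ν₀ x *
      (‖v‖ ^ (-((d : ℝ) + (α - β))) * Gf ν₀ (φ t) x ((ε * ‖v‖ ^ (-β)) • v)) := by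
  have hv0 : 0 < ‖v‖ := by linarith [H.hR]
  unfold Pf Gf
  rw [chi_large H.hR H.hν_eq φ ε t x v hv, Qf_eq H.f0 (H.ps t), H.hν_eq x v hv, H.hF_eq v hv]
  have : ‖v‖ ^ (-((d : ℝ) + (α - β))) = ‖v‖ ^ β * ‖v‖ ^ (-(α + (d : ℝ))) := by
    rw [← Real.rpow_add hv0]; ring_nf
  rw [this]; ring

theorem Pf_meas (H : Hyp α β γ κ R ν₁ ν₂ l0 m1 m2 l N A M C1 C2 ν₀ ν F φ) (ε t : ℝ) (x : Euc d) :
    Measurable (Pf β ν F φ ε t x) := by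
  unfold Pf
  have h1 := chi_meas H.hν_meas β ε t (H.ps t).cont x
  have h2 : Measurable (fun v => ν x v) := H.hν_meas.comp (g := fun p : Euc d × Euc d => ν p.1 p.2)
    (f := fun v => (x, v)) (by fun_prop)
  have h3 := H.hF_meas
  fun_prop

theorem Pf_int (H : Hyp α β γ κ R ν₁ ν₂ l0 m1 m2 l N A M C1 C2 ν₀ ν F φ) (ε t : ℝ) (x : Euc d) :
    Integrable (Pf β ν F φ ε t x) := by
  have hm := Pf_meas H ε t x
  have hK0 := Kc_nonneg H.f0 (H.ps t)
  have hν0 := H.f0.pos.trans_le (H.f0.lo x)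
  have hκ := H.hκ
  rw [← integrableOn_univ, ← compl_union_self {v : Euc d | R ≤ ‖v‖}, compl_out]
  refine IntegrableOn.union ?_ ?_
  · refine Integrable.mono' ((H.hF_int.const_mul (N * (Kc m2 l M C1 C2 *
      ∫ z in Ioi (0 : ℝ), Real.exp (-(z * m1))))).integrableOn) hm.aestronglyMeasurable ?_
    rw [ae_restrict_iff' measurableSet_ball]
    refine Filter.Eventually.of_forall fun v hv => ?_
    have hv : ‖v‖ ≤ R := by simpa using (mem_ball_zero_iff.1 hv).le
    unfold Pf
    rw [chi_eq, Real.norm_eq_abs, abs_mul, abs_mul, abs_of_pos (H.hν_pos x v),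
      abs_of_pos (H.hF_pos v)]
    have h1 := Qf_bd (H.nuv v hv) (H.ps t) x ((ε * jfloor (-β) v) • v)
    have h2 := H.hν_le x v hv
    have h3 := H.hF_pos v
    have h4 := H.hν_pos x v
    calc _ ≤ N * F v * _ := by
            exact mul_le_mul (mul_le_mul_of_nonneg_right h2 h3.le) h1 (abs_nonneg _)
              (mul_nonneg (h4.le.trans h2) h3.le)
      _ = _ := by ring
  · refine Integrable.mono' ((tail_int H.hd (q := α - β) (by linarith [H.hβα])
      (by linarith [H.hR])).const_mul (κ * ν₀ x * (2 * Kc ν₂ l0 M C1 C2 * J2 ν₁)))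
      hm.aestronglyMeasurable ?_
    rw [ae_restrict_iff' (meas_out R)]
    refine Filter.Eventually.of_forall fun v hv => ?_
    rw [Pf_large H ε t x v hv, Real.norm_eq_abs, abs_mul, abs_of_pos (mul_pos hκ hν0), abs_mul,
      abs_of_nonneg (Real.rpow_nonneg (norm_nonneg v) _), mul_assoc (κ * ν₀ x),
      mul_comm (2 * Kc ν₂ l0 M C1 C2 * J2 ν₁)]
    have := Gf_bd H.f0 (H.ps t) x ((ε * ‖v‖ ^ (-β)) • v)
    gcongr

theorem Pf_out (H : Hyp α β γ κ R ν₁ ν₂ l0 m1 m2 l N A M C1 C2 ν₀ ν F φ) {ε : ℝ} (hε : 0 < ε) (t : ℝ)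
    (x : Euc d) : ∫ v in {v : Euc d | R ≤ ‖v‖}, Pf β ν F φ ε t x v = κ * ν₀ x *
      (ε ^ γ / (1 - β) * ∫ w in {w : Euc d | ε * R ^ (1 - β) ≤ ‖w‖},
        Gf ν₀ (φ t) x w / ‖w‖ ^ ((d : ℝ) + γ)) := by
  rw [← cv_lemma H.hd H.hβα H.hβ1 H.hγ hε (by linarith [H.hR]) (Gf_meas H.f0 (H.ps t) x)
    (Gf_bd H.f0 (H.ps t) x), ← integral_const_mul]
  exact setIntegral_congr_fun (meas_out R) fun v hv => Pf_large H ε t x v hv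

/-- first order estimate of the inner part -/
theorem Pf_in_lin (H : Hyp α β γ κ R ν₁ ν₂ l0 m1 m2 l N A M C1 C2 ν₀ ν F φ) {ε : ℝ} (hε : 0 < ε)
    (t : ℝ) (x : Euc d) : |∫ v in Metric.ball (0 : Euc d) R, Pf β ν F φ ε t x v| ≤
      N * (Kc m2 l M C1 C2 * (A * R) * ∫ z in Ioi (0 : ℝ), z * Real.exp (-(z * m1))) * ε := by
  set I := ∫ z in Ioi (0 : ℝ), z * Real.exp (-(z * m1)) with hI
  have hI0 : 0 ≤ I := setIntegral_nonneg measurableSet_Ioi fun z hz => by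
    have : (0 : ℝ) < z := hz
    positivity
  have hN : 0 ≤ N := (H.hν_pos x 0).le.trans (H.hν_le x 0 (by simp; linarith [H.hR]))
  have hA : 0 ≤ A := (jfloor_pos (0 : Euc d)).le.trans (H.hj_le 0 (by simp; linarith [H.hR]))
  have hR0 : 0 < R := by linarith [H.hR]
  have hK0 := Kc_nonneg (H.nuv 0 (by simp; linarith [H.hR])) (H.ps t)
  rw [← Real.norm_eq_abs]
  calc _ ≤ ∫ v in Metric.ball (0 : Euc d) R, (N * (Kc m2 l M C1 C2 * (A * R) * I) * ε) * F v := by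
        refine norm_integral_le_of_norm_le (H.hF_int.const_mul _).integrableOn ?_
        rw [ae_restrict_iff' measurableSet_ball]
        refine Filter.Eventually.of_forall fun v hv => ?_
        have hv : ‖v‖ ≤ R := by simpa using (mem_ball_zero_iff.1 hv).le
        unfold Pf
        rw [chi_eq, Real.norm_eq_abs, abs_mul, abs_mul, abs_of_pos (H.hν_pos x v),
          abs_of_pos (H.hF_pos v)]
        have h1 := Qf_lin (H.nuv v hv) (H.ps t) x ((ε * jfloor (-β) v) • v)
        have hj := jfloor_pos (b := -β) v
        rw [norm_smul, Real.norm_eq_abs, abs_of_pos (mul_pos hε hj), ← hI] at h1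
        have h2 := H.hν_le x v hv
        have h3 := H.hF_pos v
        have h4 := H.hν_pos x v
        have h5 := H.hj_le v hv
        calc _ ≤ N * F v * (Kc m2 l M C1 C2 * (ε * A * R) * I) := by
              refine mul_le_mul (mul_le_mul_of_nonneg_right h2 h3.le) (h1.trans ?_) (abs_nonneg _)
                (mul_nonneg (h4.le.trans h2) h3.le)
              gcongr
          _ = _ := by ring
    _ = (N * (Kc m2 l M C1 C2 * (A * R) * I) * ε) * ∫ v in Metric.ball (0 : Euc d) R, F v :=
        integral_const_mul _ _
    _ ≤ (N * (Kc m2 l M C1 C2 * (A * R) * I) * ε) * 1 := by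
        gcongr
        rw [← H.hF_mass]
        exact setIntegral_le_integral H.hF_int (Filter.Eventually.of_forall fun v => (H.hF_pos v).le)
    _ = _ := mul_one _

theorem Fv_ball_int (H : Hyp α β γ κ R ν₁ ν₂ l0 m1 m2 l N A M C1 C2 ν₀ ν F φ) (r : ℝ) {s : Set (Euc d)}
    (hs : MeasurableSet s) (hr : ∀ v ∈ s, ‖v‖ ≤ r) : IntegrableOn (fun v => F v • v) s := by
  refine Integrable.mono' ((H.hF_int.const_mul r).integrableOn) ?_ ?_
  · exact (H.hF_meas.smul measurable_id).aestronglyMeasurable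
  · rw [ae_restrict_iff' hs]
    refine Filter.Eventually.of_forall fun v hv => ?_
    rw [norm_smul, Real.norm_eq_abs, abs_of_pos (H.hF_pos v), mul_comm]
    exact mul_le_mul_of_nonneg_right (hr v hv) (H.hF_pos v).le

/-- second order estimate of the inner part -/
theorem Pf_in_quad (H : Hyp α β γ κ R ν₁ ν₂ l0 m1 m2 l N A M C1 C2 ν₀ ν F φ) {ε : ℝ} (hε : 0 < ε)
    (t : ℝ) (x : Euc d) : |(∫ v in Metric.ball (0 : Euc d) R, Pf β ν F φ ε t x v) -
      ε * fderiv ℝ (fun y => φ t y) x (∫ v in Metric.ball (0 : Euc d) R, F v • v)| ≤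
      N * (Kc m2 l M C1 C2 * (A * R) ^ 2 *
        ∫ z in Ioi (0 : ℝ), z ^ 2 * ((1 + z) * Real.exp (-(z * m1)))) * ε ^ 2 := by
  set I := ∫ z in Ioi (0 : ℝ), z ^ 2 * ((1 + z) * Real.exp (-(z * m1))) with hI
  have hI0 : 0 ≤ I := setIntegral_nonneg measurableSet_Ioi fun z hz => by
    have : (0 : ℝ) < z := hz
    positivity
  have hN : 0 ≤ N := (H.hν_pos x 0).le.trans (H.hν_le x 0 (by simp; linarith [H.hR]))
  have hA : 0 ≤ A := (jfloor_pos (0 : Euc d)).le.trans (H.hj_le 0 (by simp; linarith [H.hR]))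
  have hR0 : 0 < R := by linarith [H.hR]
  have hK0 := Kc_nonneg (H.nuv 0 (by simp; linarith [H.hR])) (H.ps t)
  set D := fderiv ℝ (fun y => φ t y) x with hD
  have hFv : IntegrableOn (fun v => F v • v) (Metric.ball (0 : Euc d) R) :=
    Fv_ball_int H R measurableSet_ball fun v hv => (mem_ball_zero_iff.1 hv).le
  rw [← ContinuousLinearMap.integral_comp_comm D hFv, ← integral_const_mul,
    ← integral_sub (Pf_int H ε t x).integrableOn ((D.integrable_comp hFv).const_mul ε),
    ← Real.norm_eq_abs]
  calc _ ≤ ∫ v in Metric.ball (0 : Euc d) R,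
          (N * (Kc m2 l M C1 C2 * (A * R) ^ 2 * I) * ε ^ 2) * F v := by
        refine norm_integral_le_of_norm_le (H.hF_int.const_mul _).integrableOn ?_
        rw [ae_restrict_iff' measurableSet_ball]
        refine Filter.Eventually.of_forall fun v hv => ?_
        have hv : ‖v‖ ≤ R := by simpa using (mem_ball_zero_iff.1 hv).le
        have h1 := Qf_quad (H.nuv v hv) (H.ps t) x ((ε * jfloor (-β) v) • v)
        have hj := jfloor_pos (b := -β) v
        have h2 := H.hν_le x v hv
        have h3 := H.hF_pos v
        have h4 := H.hν_pos x v
        have h5 := H.hj_le v hv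
        rw [norm_smul, Real.norm_eq_abs, abs_of_pos (mul_pos hε hj), ← hI, ← chi_eq] at h1
        have e : Pf β ν F φ ε t x v - ε * D (F v • v) = ν x v * F v *
            (chiAux ν β φ ε t x v - φ t x -
              D ((ε * jfloor (-β) v) • v) / (jfloor (-β) v * ν x v)) := by
          unfold Pf
          rw [map_smul, map_smul, smul_eq_mul, smul_eq_mul]
          field_simp
        rw [e, Real.norm_eq_abs, abs_mul, abs_mul, abs_of_pos h4, abs_of_pos h3]
        calc _ ≤ N * F v * (Kc m2 l M C1 C2 * (ε * A * R) ^ 2 * I) := by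
              refine mul_le_mul (mul_le_mul_of_nonneg_right h2 h3.le) (h1.trans ?_) (abs_nonneg _)
                (mul_nonneg (h4.le.trans h2) h3.le)
              gcongr
          _ = _ := by ring
    _ = (N * (Kc m2 l M C1 C2 * (A * R) ^ 2 * I) * ε ^ 2) * ∫ v in Metric.ball (0 : Euc d) R, F v :=
        integral_const_mul _ _
    _ ≤ (N * (Kc m2 l M C1 C2 * (A * R) ^ 2 * I) * ε ^ 2) * 1 := by
        gcongr
        rw [← H.hF_mass]
        exact setIntegral_le_integral H.hF_int (Filter.Eventually.of_forall fun v => (H.hF_pos v).le)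
    _ = _ := mul_one _

/-- an odd integral vanishes -/
theorem odd_zero (H : Hyp α β γ κ R ν₁ ν₂ l0 m1 m2 l N A M C1 C2 ν₀ ν F φ) {s : Set (Euc d)}
    (hs : MeasurableSet s) (hsR : ∀ v ∈ s, R ≤ ‖v‖) (hneg : ∀ v, -v ∈ s ↔ v ∈ s) :
    ∫ v in s, F v • v = 0 := by
  have h1 : ∫ v in s, F v • v = ∫ v, s.indicator (fun v => F v • v) v := (integral_indicator hs).symm
  have h2 := integral_neg_eq_self (s.indicator (fun v => F v • v)) (volume : Measure (Euc d))
  have h3 : (fun v => s.indicator (fun v => F v • v) (-v)) =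
      fun v => -(s.indicator (fun v => F v • v) v) := by
    ext1 v
    by_cases hv : v ∈ s
    · rw [indicator_of_mem ((hneg v).2 hv), indicator_of_mem hv, H.hF_eq v (hsR v hv),
        H.hF_eq (-v) (by rw [norm_neg]; exact hsR v hv), norm_neg, smul_neg]
    · rw [indicator_of_notMem (fun h => hv ((hneg v).1 h)), indicator_of_notMem hv, neg_zero]
  rw [h3, integral_neg] at h2
  rw [h1]
  set J := ∫ v, s.indicator (fun v => F v • v) v
  have h4 : (2 : ℝ) • J = 0 := by
    rw [two_smul]; nth_rewrite 1 [← h2]; exact neg_add_cancel J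
  exact (smul_eq_zero.1 h4).resolve_left two_ne_zero

theorem drift_eq (H : Hyp α β γ κ R ν₁ ν₂ l0 m1 m2 l N A M C1 C2 ν₀ ν F φ) (h1 : 1 ≤ α) :
    ∀ᶠ ε in nhdsWithin (0 : ℝ) (Ioi 0),
      jdrift F α β ε = ∫ v in Metric.ball (0 : Euc d) R, F v • v := by
  rcases h1.eq_or_lt with h | h
  · have hβ : 0 < 1 - β := by linarith [H.hβ1]
    have hR0 : 0 < R := by linarith [H.hR]
    have hev : ∀ᶠ ε in nhdsWithin (0 : ℝ) (Ioi 0), ε < R ^ (-(1 - β)) :=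
      nhdsWithin_le_nhds (eventually_lt_nhds (by positivity))
    filter_upwards [hev, self_mem_nhdsWithin] with ε hε hε0
    have hε0 : 0 < ε := hε0
    have hr : R < ε ^ (-(1 / (1 - β))) := by
      have := Real.rpow_lt_rpow_of_neg hε0 hε (z := -(1 / (1 - β)))
        (by rw [neg_lt_zero]; positivity)
      rwa [← Real.rpow_mul hR0.le, neg_mul_neg, mul_one_div_cancel hβ.ne', Real.rpow_one] at this
    unfold jdrift
    rw [if_neg (by linarith), if_pos h.symm]
    set r := ε ^ (-(1 / (1 - β)))
    have hsplit : Metric.closedBall (0 : Euc d) r =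
        Metric.ball 0 R ∪ (Metric.closedBall 0 r \ Metric.ball 0 R) :=
      (union_sdiff_cancel ((Metric.ball_subset_closedBall).trans
        (Metric.closedBall_subset_closedBall hr.le))).symm
    have hm : MeasurableSet (Metric.closedBall (0 : Euc d) r \ Metric.ball 0 R) :=
      measurableSet_closedBall.diff measurableSet_ball
    rw [hsplit, setIntegral_union disjoint_sdiff_right hm, odd_zero H hm, add_zero]
    · intro v hv
      simpa using hv.2
    · intro v; simp
    · exact Fv_ball_int H R measurableSet_ball fun v hv => (mem_ball_zero_iff.1 hv).le
    · exact Fv_ball_int H r hm fun v hv => by simpa using hv.1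
  · refine Filter.Eventually.of_forall fun ε => ?_
    unfold jdrift
    rw [if_neg (by linarith), if_neg (by linarith)]
    have hR0 : 0 < R := by linarith [H.hR]
    have hball : IntegrableOn (fun v => F v • v) (Metric.ball (0 : Euc d) R) :=
      Fv_ball_int H R measurableSet_ball fun v hv => (mem_ball_zero_iff.1 hv).le
    have hout : IntegrableOn (fun v => F v • v) {v : Euc d | R ≤ ‖v‖} := by
      refine Integrable.mono' ((tail_int H.hd (q := α - 1) (by linarith) hR0).const_mul κ) ?_ ?_
      · exact (H.hF_meas.smul measurable_id).aestronglyMeasurable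
      · rw [ae_restrict_iff' (meas_out R)]
        refine Filter.Eventually.of_forall fun v (hv : R ≤ ‖v‖) => ?_
        have hv0 : 0 < ‖v‖ := by linarith
        rw [norm_smul, Real.norm_eq_abs, abs_of_pos (H.hF_pos v), H.hF_eq v hv, mul_assoc,
          ← Real.rpow_add_one hv0.ne']
        apply le_of_eq
        ring_nf
    rw [← setIntegral_univ, ← compl_union_self {v : Euc d | R ≤ ‖v‖}, compl_out,
      setIntegral_union _ (meas_out R) hball hout, odd_zero H (meas_out R) (fun v hv => hv),
      add_zero]
    · intro v; simp
    · rw [← compl_out]; exact disjoint_compl_left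

theorem inner_part (H : Hyp α β γ κ R ν₁ ν₂ l0 m1 m2 l N A M C1 C2 ν₀ ν F φ) :
    ∃ Cs q : ℝ, γ < q ∧ ∀ᶠ ε in nhdsWithin (0 : ℝ) (Ioi 0), ∀ t x,
      |(∫ v in Metric.ball (0 : Euc d) R, Pf β ν F φ ε t x v) -
        ε * fderiv ℝ (fun y => φ t y) x (jdrift F α β ε)| ≤ Cs * ε ^ q := by
  rcases lt_or_ge α 1 with h | h
  · refine ⟨N * (Kc m2 l M C1 C2 * (A * R) * ∫ z in Ioi (0 : ℝ), z * Real.exp (-(z * m1))), 1, ?_, ?_⟩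
    rotate_left
    · filter_upwards [self_mem_nhdsWithin] with ε hε t x
      have := Pf_in_lin H hε t x
      unfold jdrift
      rw [if_pos h, map_zero, mul_zero, sub_zero, Real.rpow_one]
      exact this
    · rw [H.hγ, div_lt_one (by linarith [H.hβ1])]; linarith
  · refine ⟨N * (Kc m2 l M C1 C2 * (A * R) ^ 2 *
        ∫ z in Ioi (0 : ℝ), z ^ 2 * ((1 + z) * Real.exp (-(z * m1)))), 2, H.hγ2, ?_⟩
    filter_upwards [self_mem_nhdsWithin, drift_eq H h] with ε hε hj t x
    have := Pf_in_quad H hε t x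
    rw [hj, Real.rpow_two]
    exact this

theorem total_eq (H : Hyp α β γ κ R ν₁ ν₂ l0 m1 m2 l N A M C1 C2 ν₀ ν F φ) (ε t : ℝ) (x : Euc d)
    (c : ℝ) : ∫ v, ν x v * F v * (chiAux ν β φ ε t x v - φ t x - ε / ν x v * c) =
      (∫ v in {v : Euc d | R ≤ ‖v‖}, Pf β ν F φ ε t x v) +
      ((∫ v in Metric.ball (0 : Euc d) R, Pf β ν F φ ε t x v) - ε * c) := by
  have e : ∀ v, ν x v * F v * (chiAux ν β φ ε t x v - φ t x - ε / ν x v * c) =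
      Pf β ν F φ ε t x v - (ε * c) * F v := by
    intro v
    have := H.hν_pos x v
    unfold Pf
    field_simp
  simp_rw [e]
  rw [integral_sub (Pf_int H ε t x) (H.hF_int.const_mul _), integral_const_mul, H.hF_mass,
    ← integral_add_compl (meas_out R) (Pf_int H ε t x), compl_out]
  ring

theorem final_bound (H : Hyp α β γ κ R ν₁ ν₂ l0 m1 m2 l N A M C1 C2 ν₀ ν F φ) {ε Cs q : ℝ} (hε : 0 < ε)
    (t : ℝ) (x : Euc d) (c : ℝ)
    (hin : |(∫ v in Metric.ball (0 : Euc d) R, Pf β ν F φ ε t x v) - ε * c| ≤ Cs * ε ^ q) :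
    |κ / (1 - β) * ((1 / 2) * ∫ h : Euc d,
        (Kf ν₀ (φ t) γ x h + Kf ν₀ (φ t) γ x (-h)) / ‖h‖ ^ ((d : ℝ) + γ)) -
      ε ^ (-γ) * ∫ v, ν x v * F v * (chiAux ν β φ ε t x v - φ t x - ε / ν x v * c)| ≤
      κ / (1 - β) * ν₂ * (2 * Kc ν₂ l0 M C1 C2 * J2 ν₁ *
        ∫ h in Metric.ball (0 : Euc d) (ε * R ^ (1 - β)), Wt γ h) + Cs * ε ^ (q - γ) := by
  have hβ : 0 < 1 - β := by linarith [H.hβ1]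
  have hR0 : 0 < R := by linarith [H.hR]
  have hκ := H.hκ
  have hν0 := H.f0.pos.trans_le (H.f0.lo x)
  have hs := sym_lemma H.hd H.hγ0 H.hγ2 (Gf_meas H.f0 (H.ps t) x) (Gf_bd H.f0 (H.ps t) x)
    (Gf_sym_bd H.f0 (H.ps t) x) (δ := ε * R ^ (1 - β)) (by positivity)
  rw [total_eq H, Pf_out H hε, main_identity H.hd H.f0 (H.ps t) H.hγ0 H.hγ2 x]
  set S := ∫ w : Euc d, (Gf ν₀ (φ t) x w + Gf ν₀ (φ t) x (-w)) / ‖w‖ ^ ((d : ℝ) + γ)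
  set B := (∫ v in Metric.ball (0 : Euc d) R, Pf β ν F φ ε t x v) - ε * c
  set T := ∫ w in {w : Euc d | ε * R ^ (1 - β) ≤ ‖w‖}, Gf ν₀ (φ t) x w / ‖w‖ ^ ((d : ℝ) + γ)
  set W := 2 * Kc ν₂ l0 M C1 C2 * J2 ν₁ * ∫ h in Metric.ball (0 : Euc d) (ε * R ^ (1 - β)), Wt γ h
  have he : ε ^ (-γ) * ε ^ γ = 1 := by rw [← Real.rpow_add hε]; simp
  have e : κ / (1 - β) * (1 / 2 * (ν₀ x * S)) -
      ε ^ (-γ) * (κ * ν₀ x * (ε ^ γ / (1 - β) * T) + B) =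
      -(κ / (1 - β) * ν₀ x * (T - 1 / 2 * S)) - ε ^ (-γ) * B := by
    linear_combination (-(κ * ν₀ x * (1 / (1 - β)) * T)) * he
  rw [e]
  refine (abs_sub _ _).trans (add_le_add ?_ ?_)
  · rw [abs_neg, abs_mul, abs_of_pos (by positivity)]
    have hW : 0 ≤ W := (abs_nonneg _).trans hs
    have := H.f0.hi x
    have := H.f0.m2pos
    gcongr
  · rw [abs_mul, abs_of_pos (by positivity)]
    calc _ ≤ ε ^ (-γ) * (Cs * ε ^ q) := by gcongr
      _ = _ := by rw [mul_left_comm, ← Real.rpow_add hε]; ring_nf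

theorem final_conv (H : Hyp α β γ κ R ν₁ ν₂ l0 m1 m2 l N A M C1 C2 ν₀ ν F φ) :
    TendstoUniformlyOn
          (fun ε (p : ℝ × Euc d) =>
            ε ^ (-γ) * ∫ v, ν p.2 v * F v *
              (chiAux ν β φ ε p.1 p.2 v - φ p.1 p.2 -
                ε / ν p.2 v * (fderiv ℝ (fun y => φ p.1 y) p.2 (jdrift F α β ε))))
          (fun p => κ / (1 - β) * ((1 / 2) * ∫ h : Euc d,
            (Kf ν₀ (φ p.1) γ p.2 h + Kf ν₀ (φ p.1) γ p.2 (-h)) / ‖h‖ ^ ((d : ℝ) + γ)))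
          (nhdsWithin 0 (Set.Ioi 0))
          (Set.Ici 0 ×ˢ Set.univ) := by
  obtain ⟨Cs, q, hq, hin⟩ := inner_part H
  have hβ : 0 < 1 - β := by linarith [H.hβ1]
  have hR0 : 0 < R := by linarith [H.hR]
  have t1 : Filter.Tendsto (fun ε : ℝ => ε * R ^ (1 - β)) (nhdsWithin 0 (Ioi 0))
      (nhdsWithin 0 (Ioi 0)) := by
    refine tendsto_nhdsWithin_iff.2 ⟨?_, ?_⟩
    · have : Filter.Tendsto (fun ε : ℝ => ε * R ^ (1 - β)) (nhds 0) (nhds (0 * R ^ (1 - β))) :=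
        Filter.tendsto_id.mul_const _
      rw [zero_mul] at this
      exact this.mono_left nhdsWithin_le_nhds
    · filter_upwards [self_mem_nhdsWithin] with ε hε
      have hε : 0 < ε := hε
      exact mem_Ioi.2 (by positivity)
  have t2 := (((omega_tendsto H.hd H.hγ0 H.hγ2).comp t1).const_mul
    (2 * Kc ν₂ l0 M C1 C2 * J2 ν₁)).const_mul (κ / (1 - β) * ν₂)
  have t3 : Filter.Tendsto (fun ε : ℝ => Cs * ε ^ (q - γ)) (nhdsWithin 0 (Ioi 0)) (nhds (Cs * 0)) := by
    have h0 : Filter.Tendsto (fun ε : ℝ => ε ^ (q - γ)) (nhds 0) (nhds ((0 : ℝ) ^ (q - γ))) :=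
      (Real.continuousAt_rpow_const 0 (q - γ) (Or.inr (by linarith))).tendsto
    rw [Real.zero_rpow (by linarith)] at h0
    exact (h0.mono_left nhdsWithin_le_nhds).const_mul Cs
  have t4 := t2.add t3
  simp only [mul_zero, add_zero, Function.comp_def] at t4
  rw [Metric.tendstoUniformlyOn_iff]
  intro e he
  filter_upwards [hin, self_mem_nhdsWithin, t4.eventually (eventually_lt_nhds he)] with ε h1 h2 h3 p _
  rw [Real.dist_eq]
  exact (final_bound H h2 p.1 p.2 _ (h1 p.1 p.2)).trans_lt h3

end part7
/-- Convergence to the limiting elliptic operator (Proposition 3.3): as `ε → 0⁺`,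
`ε^{−γ} ∫ ν F (χ^ε − φ − (ε/ν) j^ε·∇_x φ) dv` converges, uniformly in `(t,x) ∈ [0,∞)×ℝ^d`,
to `(κ/(1−β))` times the principal value `lim_{δ→0⁺} ∫_{|y−x|≥δ} η(x,y)(φ(t,y)−φ(t,x))/|x−y|^{d+γ} dy`,
i.e. to `−κ 𝓛*(φ)(t,x)`. -/
theorem convergence_to_elliptic_operator (d : ℕ) (hd : 1 ≤ d)
    (α β γ κ R ν₁ ν₂ : ℝ)
    (hα : 0 < α) (hβ : β < min α (2 - α)) (hγ : γ = (α - β) / (1 - β))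
    (hκ : 0 < κ) (hR : 1 ≤ R) (hν₁ : 0 < ν₁) (h12 : ν₁ ≤ ν₂)
    (ν₀ : Euc d → ℝ) (hν₀_icc : ∀ x, ν₀ x ∈ Set.Icc ν₁ ν₂)
    (hν₀_C1 : ContDiff ℝ 1 ν₀) (hν₀_grad : ∃ C, ∀ x, ‖fderiv ℝ ν₀ x‖ ≤ C)
    (ν : Euc d → Euc d → ℝ)
    (hν_meas : Measurable fun p : Euc d × Euc d => ν p.1 p.2)
    (hν_bound : ∀ x v, ν₁ * Real.sqrt (1 + ‖v‖ ^ 2) ^ β ≤ ν x v ∧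
      ν x v ≤ ν₂ * Real.sqrt (1 + ‖v‖ ^ 2) ^ β)
    (hν_C1 : ∀ v, ContDiff ℝ 1 fun x => ν x v)
    (hν_grad : ∃ C, ∀ x v, Real.sqrt (1 + ‖v‖ ^ 2) ^ (-β) * ‖fderiv ℝ (fun y => ν y v) x‖ ≤ C)
    (hν_eq : ∀ x v, R ≤ ‖v‖ → ν x v = ν₀ x * ‖v‖ ^ β)
    (F : Euc d → ℝ) (hF_pos : ∀ v, 0 < F v) (hF_meas : Measurable F)
    (hF_int : Integrable F) (hF_mass : (∫ v, F v) = 1)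
    (hF_eq : ∀ v : Euc d, R ≤ ‖v‖ → F v = κ * ‖v‖ ^ (-(α + (d : ℝ))))
    (φ : ℝ → Euc d → ℝ)
    (hφ : ContDiff ℝ (⊤ : ℕ∞) fun p : ℝ × Euc d => φ p.1 p.2)
    (hφc : HasCompactSupport fun p : ℝ × Euc d => φ p.1 p.2) :
    ∃ L : ℝ → Euc d → ℝ,
      (∀ t x, 0 ≤ t →
        Filter.Tendsto
          (fun δ : ℝ => ∫ y in {y : Euc d | δ ≤ ‖y - x‖},
            etaKer ν₀ γ x y * (φ t y - φ t x) / ‖x - y‖ ^ ((d : ℝ) + γ))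
          (nhdsWithin 0 (Set.Ioi 0)) (nhds (L t x)))
      ∧ TendstoUniformlyOn
          (fun ε (p : ℝ × Euc d) =>
            ε ^ (-γ) * ∫ v, ν p.2 v * F v *
              (chiAux ν β φ ε p.1 p.2 v - φ p.1 p.2 -
                ε / ν p.2 v * (fderiv ℝ (fun y => φ p.1 y) p.2 (jdrift F α β ε))))
          (fun p => κ / (1 - β) * L p.1 p.2)
          (nhdsWithin 0 (Set.Ioi 0))
          (Set.Ici 0 ×ˢ Set.univ) := by
  have hβα : β < α := hβ.trans_le (min_le_left _ _)
  have hβ2 : β < 2 - α := hβ.trans_le (min_le_right _ _)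
  have hβ1 : β < 1 := by linarith
  have hγ0 : 0 < γ := by rw [hγ]; exact div_pos (by linarith) (by linarith)
  have hγ2 : γ < 2 := by rw [hγ, div_lt_iff₀ (by linarith)]; linarith
  obtain ⟨l0, hl0⟩ := hν₀_grad
  obtain ⟨C, hC⟩ := hν_grad
  obtain ⟨M, C1, C2, hps⟩ := psi_ok φ hφ hφc
  have hf0 := nu0_ok hν₁ hν₀_icc hν₀_C1 hl0
  have H : Hyp α β γ κ R ν₁ ν₂ l0
      (min 1 (R ^ (-β)) * (ν₁ * min 1 (Real.sqrt (1 + R ^ 2) ^ β)))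
      (max 1 (R ^ (-β)) * (ν₂ * max 1 (Real.sqrt (1 + R ^ 2) ^ β)))
      (max 1 (R ^ (-β)) * (C * max 1 (Real.sqrt (1 + R ^ 2) ^ β)))
      (ν₂ * max 1 (Real.sqrt (1 + R ^ 2) ^ β)) (max 1 (R ^ (-β))) M C1 C2 ν₀ ν F φ :=
    { hd := hd, hα := hα, hβ1 := hβ1, hβα := hβα, hγ := hγ, hγ0 := hγ0, hγ2 := hγ2, hR := hR
      f0 := hf0, hν_meas := hν_meas
      hν_pos := fun x v => lt_of_lt_of_le (by positivity) (hν_bound x v).1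
      hν_le := fun x v hv => (hν_bound x v).2.trans (mul_le_mul_of_nonneg_left
        (rpow_between (bracket_between v hv).1 (bracket_between v hv).2).2 (by linarith))
      hj_le := fun v hv => (jfloor_between hR v hv).2
      hν_eq := hν_eq, hF_pos := hF_pos, hF_meas := hF_meas, hF_int := hF_int
      hF_mass := hF_mass, hF_eq := hF_eq, hκ := hκ
      nuv := fun v hv => nuv_ok hR hν₁ h12 hν_bound hν_C1 hC v hv
      ps := hps }
  refine ⟨fun t x => (1 / 2) * ∫ h : Euc d,
    (Kf ν₀ (φ t) γ x h + Kf ν₀ (φ t) γ x (-h)) / ‖h‖ ^ ((d : ℝ) + γ), fun t x _ => ?_, ?_⟩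
  · exact pv_lemma hd hf0 (hps t) hγ0 hγ2 x
  · exact final_conv H
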